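/- arXiv:1811.11052 — 9 statements merged into one kernel-verified Lean document; each statement's English description precedes it below -/
import Mathlib

section
/- Let J be a finite index set and (u_j)_{j∈J} a family of pairwise distinct vectors in ℝ^n. There exist N ∈ ℕ and δ₀ > 0, depending only on (u_j)_{j∈J}, such that for every δ ∈ (0,δ₀) and every family of nonnegative coefficients (d_j)_{j∈J}, inf_{|y| ≤ N log(1/δ)} ∑_{j∈J} d_j exp(⟨u_j, y⟩) ≤ inf_{y ∈ ℝ^n} ∑_{j∈J} d_j exp(⟨u_j, y⟩) + δ · max_{j∈J} d_j. -/
open scoped RealInnerProductSpace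
open Filter Topology

/-- The points at which every functional `⟪u j, ·⟫` is at most the maximum of `-1` and its value
at `y`. -/
def truncatedPolyhedron {E J : Type*} [NormedAddCommGroup E] [InnerProductSpace ℝ E]
    (u : J → E) (y : E) : Set E :=
  {z | ∀ j, ⟪u j, z⟫ ≤ max ⟪u j, y⟫ (-1)}

section TruncatedPolyhedron

variable {E J : Type*} [NormedAddCommGroup E] [InnerProductSpace ℝ E]

theorem self_mem_truncatedPolyhedron (u : J → E) (y : E) : y ∈ truncatedPolyhedron u y :=
  fun _ => le_max_left _ _

theorem truncatedPolyhedron_subset {u : J → E} {y z : E} (hz : z ∈ truncatedPolyhedron u y) :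
    truncatedPolyhedron u z ⊆ truncatedPolyhedron u y :=
  fun _ hw j => (hw j).trans (max_le (hz j) (le_max_right _ _))

theorem isClosed_truncatedPolyhedron (u : J → E) (y : E) :
    IsClosed (truncatedPolyhedron u y) := by
  simp only [truncatedPolyhedron, Set.ofPred_forall]
  exact isClosed_iInter fun j => isClosed_le (by fun_prop) continuous_const

theorem exists_norm_minimal_mem_truncatedPolyhedron [FiniteDimensional ℝ E] (u : J → E) (y : E) :
    ∃ z ∈ truncatedPolyhedron u y, ∀ w ∈ truncatedPolyhedron u y, ‖z‖ ≤ ‖w‖ := by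
  have : ProperSpace E := FiniteDimensional.proper ℝ E
  obtain ⟨z, hz, h⟩ := (isClosed_truncatedPolyhedron u y).exists_infDist_eq_dist
    ⟨y, self_mem_truncatedPolyhedron u y⟩ 0
  refine ⟨z, hz, fun w hw => ?_⟩
  simpa [h] using Metric.infDist_le_dist_of_mem (x := (0 : E)) hw

/-- If the norms of `z k` tend to infinity and their directions converge to `v`, then eventually
`z k - v` is a shorter element of the truncated polyhedron of `z k`. -/
theorem eventually_sub_mem_truncatedPolyhedron [Finite J] (u : J → E) {z : ℕ → E} {v : E}
    (hz : Tendsto (fun k => ‖z k‖) atTop atTop)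
    (hv : Tendsto (fun k => ‖z k‖⁻¹ • z k) atTop (𝓝 v)) (hv1 : ‖v‖ = 1) :
    ∀ᶠ k in atTop, z k - v ∈ truncatedPolyhedron u (z k) ∧ ‖z k - v‖ < ‖z k‖ := by
  have hinner (w : E) : Tendsto (fun k => ⟪w, ‖z k‖⁻¹ • z k⟫) atTop (𝓝 ⟪w, v⟫) :=
    tendsto_const_nhds.inner hv
  have hscale (w : E) : (fun k => ‖z k‖ * ⟪w, ‖z k‖⁻¹ • z k⟫) =ᶠ[atTop] fun k => ⟪w, z k⟫ := by
    filter_upwards [hz.eventually_gt_atTop 0] with k hk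
    rw [real_inner_smul_right, mul_inv_cancel_left₀ hk.ne']
  have hmem : ∀ᶠ k in atTop, ∀ j, ⟪u j, z k - v⟫ ≤ max ⟪u j, z k⟫ (-1) := by
    refine eventually_all.2 fun j => ?_
    rcases le_or_gt 0 ⟪u j, v⟫ with hj | hj
    · refine Eventually.of_forall fun k => le_max_of_le_left ?_
      rw [inner_sub_right]
      linarith
    · have h := (hz.atTop_mul_neg hj (hinner (u j))).congr' (hscale (u j))
      filter_upwards [h.eventually_le_atBot (⟪u j, v⟫ - 1)] with k hk
      refine le_max_of_le_right ?_
      rw [inner_sub_right]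
      linarith
  have hvv : 0 < ⟪v, v⟫ := by rw [real_inner_self_eq_norm_sq, hv1]; norm_num
  have h := (hz.atTop_mul_pos hvv (hinner v)).congr' (hscale v)
  filter_upwards [hmem, h.eventually_ge_atTop 1] with k hk hk1
  refine ⟨hk, lt_of_pow_lt_pow_left₀ 2 (norm_nonneg _) ?_⟩
  rw [norm_sub_sq_real, hv1, real_inner_comm]
  linarith

/-- Truncated polyhedra contain points of norm bounded independently of the base point. -/
theorem exists_bound_truncatedPolyhedron [FiniteDimensional ℝ E] [Finite J] (u : J → E) :
    ∃ C : ℝ, ∀ y, ∃ z ∈ truncatedPolyhedron u y, ‖z‖ ≤ C := by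
  by_contra! hC
  choose y hy using fun k : ℕ => hC k
  choose z hz hmin using fun k => exists_norm_minimal_mem_truncatedPolyhedron u (y k)
  have hlarge (k : ℕ) : (k : ℝ) < ‖z k‖ := hy k (z k) (hz k)
  have htop : Tendsto (fun k => ‖z k‖) atTop atTop :=
    tendsto_atTop_mono (fun k => (hlarge k).le) tendsto_natCast_atTop_atTop
  have : ProperSpace E := FiniteDimensional.proper ℝ E
  have hsphere (k : ℕ) : ‖z k‖⁻¹ • z k ∈ Metric.sphere (0 : E) 1 := by
    have hpos : 0 < ‖z k‖ := (Nat.cast_nonneg k).trans_lt (hlarge k)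
    rw [mem_sphere_zero_iff_norm, norm_smul, norm_inv, norm_norm, inv_mul_cancel₀ hpos.ne']
  obtain ⟨v, hv, φ, hφ, hlim⟩ := (isCompact_sphere (0 : E) 1).tendsto_subseq hsphere
  obtain ⟨k, hmem, hlt⟩ := (eventually_sub_mem_truncatedPolyhedron u
    (htop.comp hφ.tendsto_atTop) hlim (mem_sphere_zero_iff_norm.1 hv)).exists
  exact hlt.not_ge (hmin _ _ (truncatedPolyhedron_subset (hz _) hmem))

/-- A Hoffman-type bound for systems of linear inequalities. -/
theorem exists_norm_le_mul_of_inner_le_max [FiniteDimensional ℝ E] [Finite J] (u : J → E) :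
    ∃ C : ℝ, 0 ≤ C ∧ ∀ (y : E) (L : ℝ), 0 < L →
      ∃ z : E, ‖z‖ ≤ C * L ∧ ∀ j, ⟪u j, z⟫ ≤ max ⟪u j, y⟫ (-L) := by
  obtain ⟨C, hC⟩ := exists_bound_truncatedPolyhedron u
  refine ⟨C, ?_, fun y L hL => ?_⟩
  · obtain ⟨z, -, hz⟩ := hC 0
    exact (norm_nonneg z).trans hz
  · obtain ⟨z, hz, hzC⟩ := hC (L⁻¹ • y)
    refine ⟨L • z, ?_, fun j => ?_⟩
    · rw [norm_smul, Real.norm_of_nonneg hL.le, mul_comm]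
      exact mul_le_mul_of_nonneg_right hzC hL.le
    · have h := mul_le_mul_of_nonneg_left (hz j) hL.le
      rwa [mul_max_of_nonneg _ _ hL.le, real_inner_smul_right, mul_inv_cancel_left₀ hL.ne',
        mul_neg_one, ← real_inner_smul_right] at h

end TruncatedPolyhedron

/-- **Theorem (effective exponential minimisation).**
Let `J` be a finite (nonempty) index set and `(u j)_{j ∈ J}` a family of pairwise distinct
vectors in `ℝ^n`.  There exist `N ∈ ℕ` and `δ₀ > 0`, depending only on `(u j)`, such that
for every `δ ∈ (0, δ₀)` and every family of nonnegative coefficients `(d j)`,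
`inf_{‖y‖ ≤ N log(1/δ)} ∑_j d j * exp ⟪u j, y⟫ ≤ inf_y ∑_j d j * exp ⟪u j, y⟫ + δ * max_j d j`. -/
theorem effective_exponential_minimisation
    {n : ℕ} {J : Type*} [Fintype J] [Nonempty J]
    (u : J → EuclideanSpace ℝ (Fin n)) (hu : Function.Injective u) :
    ∃ (N : ℕ) (δ₀ : ℝ), 0 < δ₀ ∧
      ∀ δ ∈ Set.Ioo (0 : ℝ) δ₀, ∀ d : J → ℝ, (∀ j, 0 ≤ d j) →
        sInf ((fun y => ∑ j, d j * Real.exp ⟪u j, y⟫) ''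
            {y : EuclideanSpace ℝ (Fin n) | ‖y‖ ≤ (N : ℝ) * Real.log (1 / δ)})
          ≤ (⨅ y : EuclideanSpace ℝ (Fin n), ∑ j, d j * Real.exp ⟪u j, y⟫)
            + δ * Finset.univ.sup' Finset.univ_nonempty d := by
  obtain ⟨C, hC0, hC⟩ := exists_norm_le_mul_of_inner_le_max u
  have hJ : (1 : ℝ) ≤ Fintype.card J := by exact_mod_cast Fintype.card_pos (α := J)
  have hJ0 : (0 : ℝ) < Fintype.card J := zero_lt_one.trans_le hJ
  refine ⟨⌈C * 2⌉₊, 1 / (Fintype.card J + 1), by positivity, fun δ hδ d hd => ?_⟩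
  have hδ0 : 0 < δ := hδ.1
  have hδJ : (Fintype.card J + 1) * δ < 1 := by
    have h := (lt_div_iff₀ (by positivity)).1 hδ.2
    linarith
  set M := Finset.univ.sup' Finset.univ_nonempty d
  have hcard : (Fintype.card J : ℝ) < 1 / δ := by
    rw [lt_div_iff₀ hδ0]
    linarith
  have hlog : Real.log (Fintype.card J / δ) ≤ 2 * Real.log (1 / δ) := by
    rw [div_eq_mul_one_div, Real.log_mul hJ0.ne' (by positivity), two_mul]
    gcongr
  have hL : 0 < Real.log (Fintype.card J / δ) :=
    Real.log_pos ((lt_div_iff₀ hδ0).2 (by nlinarith))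
  rw [← sub_le_iff_le_add]
  refine le_ciInf fun y => ?_
  rw [sub_le_iff_le_add]
  obtain ⟨z, hzL, hz⟩ := hC y _ hL
  have hzN : ‖z‖ ≤ (⌈C * 2⌉₊ : ℝ) * Real.log (1 / δ) := by
    have hlog0 : 0 ≤ Real.log (1 / δ) := by linarith
    calc ‖z‖ ≤ C * (2 * Real.log (1 / δ)) := hzL.trans (mul_le_mul_of_nonneg_left hlog hC0)
      _ = C * 2 * Real.log (1 / δ) := by ring
      _ ≤ _ := mul_le_mul_of_nonneg_right (Nat.le_ceil _) hlog0
  have hterm (j : J) : d j * Real.exp ⟪u j, z⟫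
      ≤ d j * Real.exp ⟪u j, y⟫ + M * (δ / Fintype.card J) := by
    have hexp : Real.exp ⟪u j, z⟫ ≤ Real.exp ⟪u j, y⟫ + δ / Fintype.card J := by
      have hneg : Real.exp (-Real.log (Fintype.card J / δ)) = δ / Fintype.card J := by
        rw [Real.exp_neg, Real.exp_log (by positivity), inv_div]
      calc Real.exp ⟪u j, z⟫ ≤ max (Real.exp ⟪u j, y⟫) (δ / Fintype.card J) := by
            rw [← hneg, ← Real.exp_monotone.map_max]
            exact Real.exp_le_exp.2 (hz j)
        _ ≤ _ := max_le_add_of_nonneg (Real.exp_pos _).le (by positivity)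
    have hM : d j ≤ M := Finset.le_sup' d (Finset.mem_univ j)
    calc d j * Real.exp ⟪u j, z⟫ ≤ d j * (Real.exp ⟪u j, y⟫ + δ / Fintype.card J) :=
          mul_le_mul_of_nonneg_left hexp (hd j)
      _ ≤ _ := by
          rw [mul_add]
          gcongr
  calc _ ≤ ∑ j, d j * Real.exp ⟪u j, z⟫ := by
        refine csInf_le ⟨0, ?_⟩ ⟨z, hzN, rfl⟩
        rintro _ ⟨w, -, rfl⟩
        exact Finset.sum_nonneg fun j _ => mul_nonneg (hd j) (Real.exp_pos _).le
    _ ≤ ∑ j, (d j * Real.exp ⟪u j, y⟫ + M * (δ / Fintype.card J)) :=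
        Finset.sum_le_sum fun j _ => hterm j
    _ = _ := by
        rw [Finset.sum_add_distrib, Finset.sum_const, Finset.card_univ, nsmul_eq_mul]
        field_simp
end

section
/- Let J be a finite index set, (u_j)_{j∈J} pairwise distinct vectors in ℝ^n, I a nonempty subset of J, and d = (d_j)_{j∈I} with every d_j > 0. Then: (i) 0 lies in the relative interior of K(I) if and only if f_I(·,d) attains its infimum and g_I(d) > 0; (ii) 0 lies in the relative boundary of K(I) if and only if f_I(·,d) does not attain its infimum and g_I(d) > 0; (iii) 0 ∉ K(I) if and only if f_I(·,d) does not attain its infimum and g_I(d) = 0. -/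
open scoped RealInnerProductSpace

section ExponentialSums

variable {E J : Type*} [NormedAddCommGroup E] [InnerProductSpace ℝ E]

theorem inner_le_of_mem_convexHull {s : Set E} {y : E} {b : ℝ} (h : ∀ x ∈ s, ⟪x, y⟫ ≤ b)
    {x : E} (hx : x ∈ convexHull ℝ s) : ⟪x, y⟫ ≤ b := by
  have hc : Convex ℝ {x : E | ⟪x, y⟫ ≤ b} :=
    convex_halfSpace_le ⟨fun a b => inner_add_left a b y, fun c a => real_inner_smul_left a y c⟩ b
  exact convexHull_min h hc hx

/-- If the origin is a relative interior point of a set, then every supporting hyperplane of the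
set at the origin contains the set. -/
theorem inner_eq_zero_of_zero_mem_intrinsicInterior {s : Set E}
    (h0 : (0 : E) ∈ intrinsicInterior ℝ s) {y : E} (hy : ∀ x ∈ s, ⟪x, y⟫ ≤ 0)
    {x : E} (hx : x ∈ s) : ⟪x, y⟫ = 0 := by
  refine le_antisymm (hy x hx) ?_
  obtain ⟨z, hz, hz0⟩ := mem_intrinsicInterior.1 h0
  obtain ⟨ε, hε, hball⟩ := Metric.mem_nhds_iff.1 (mem_interior_iff_mem_nhds.1 hz)
  have hmem0 : (0 : E) ∈ affineSpan ℝ s := hz0 ▸ z.2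
  have hmem : ∀ t : ℝ, t • x ∈ affineSpan ℝ s := fun t => by
    simpa [AffineMap.lineMap_apply] using
      AffineMap.lineMap_mem t hmem0 (subset_affineSpan ℝ s hx)
  obtain ⟨t, ht, htx⟩ : ∃ t : ℝ, 0 < t ∧ t * ‖x‖ < ε := by
    refine ⟨ε / (‖x‖ + 1), by positivity, ?_⟩
    rw [div_mul_eq_mul_div, div_lt_iff₀ (by positivity)]
    nlinarith [norm_nonneg x]
  have hin : (-t) • x ∈ s := by
    have : (⟨(-t) • x, hmem (-t)⟩ : affineSpan ℝ s) ∈ Metric.ball z ε := by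
      rw [Metric.mem_ball, Subtype.dist_eq, hz0, dist_zero_right, norm_smul, norm_neg,
        Real.norm_of_nonneg ht.le]
      exact htx
    exact hball this
  have h := hy _ hin
  rw [real_inner_smul_left] at h
  nlinarith

/-- If no nontrivial closed half-space bounded by a hyperplane through the origin contains a finite
family, then the support function of the family is coercive on its span. -/
theorem exists_pos_mul_norm_le_inner [FiniteDimensional ℝ E] {u : J → E} {I : Finset J}
    (hI : I.Nonempty)
    (h : ∀ y : E, (∀ j ∈ I, ⟪u j, y⟫ ≤ 0) → ∀ j ∈ I, ⟪u j, y⟫ = 0) :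
    ∃ c : ℝ, 0 < c ∧ ∀ y ∈ Submodule.span ℝ (u '' (I : Set J)),
      ∃ j ∈ I, c * ‖y‖ ≤ ⟪u j, y⟫ := by
  set S := Submodule.span ℝ (u '' (I : Set J)) with hS
  have hcomp : IsCompact (Metric.sphere (0 : E) 1 ∩ S) :=
    (isCompact_sphere 0 1).inter_right S.closed_of_finiteDimensional
  have hcont : Continuous fun y : E => I.sup' hI fun j => ⟪u j, y⟫ :=
    Continuous.finset_sup'_apply hI fun j _ => continuous_const.inner continuous_id
  have hpos : ∀ y ∈ Metric.sphere (0 : E) 1 ∩ S, 0 < I.sup' hI fun j => ⟪u j, y⟫ := by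
    rintro y ⟨hy1, hyS⟩
    by_contra! hle
    have hz := h y fun j hj => (Finset.le_sup' (fun j => ⟪u j, y⟫) hj).trans hle
    have hy : ⟪y, y⟫ = 0 := by
      refine Submodule.span_induction (p := fun x _ => ⟪x, y⟫ = 0) ?_ (inner_zero_left y) ?_ ?_ hyS
      · rintro _ ⟨j, hj, rfl⟩
        exact hz j hj
      · intro a b _ _ ha hb
        rw [inner_add_left, ha, hb, add_zero]
      · intro t a _ ha
        rw [real_inner_smul_left, ha, mul_zero]
    rw [inner_self_eq_zero] at hy
    simp [hy] at hy1
  obtain ⟨c, hc, hcle⟩ : ∃ c : ℝ, 0 < c ∧ ∀ y ∈ Metric.sphere (0 : E) 1 ∩ S,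
      c ≤ I.sup' hI fun j => ⟪u j, y⟫ := by
    rcases (Metric.sphere (0 : E) 1 ∩ (S : Set E)).eq_empty_or_nonempty with he | hne
    · exact ⟨1, one_pos, by simp [he]⟩
    · obtain ⟨y, hy, hmin⟩ := hcomp.exists_isMinOn hne hcont.continuousOn
      exact ⟨_, hpos y hy, fun z hz => hmin hz⟩
  refine ⟨c, hc, fun y hy => ?_⟩
  rcases eq_or_ne y 0 with rfl | hy0
  · obtain ⟨j, hj⟩ := hI
    exact ⟨j, hj, by simp⟩
  have hn : 0 < ‖y‖ := norm_pos_iff.2 hy0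
  have hmem : ‖y‖⁻¹ • y ∈ Metric.sphere (0 : E) 1 ∩ S :=
    ⟨by simp [norm_smul, hn.ne'], S.smul_mem _ hy⟩
  obtain ⟨j, hj, hle⟩ := (Finset.le_sup'_iff hI).1 (hcle _ hmem)
  refine ⟨j, hj, ?_⟩
  rwa [real_inner_smul_right, inv_mul_eq_div, le_div_iff₀ hn] at hle

/-- Inner products with vectors of a span are unchanged by projecting the other argument to it. -/
theorem inner_starProjection_span_eq [FiniteDimensional ℝ E] {s : Set E} {x : E}
    (hx : x ∈ Submodule.span ℝ s) (y : E) :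
    ⟪x, (Submodule.span ℝ s).starProjection y⟫ = ⟪x, y⟫ := by
  rw [← Submodule.inner_starProjection_left_eq_right,
    Submodule.starProjection_eq_self_iff.2 hx]

theorem zero_mem_intrinsicInterior_convexHull [FiniteDimensional ℝ E] {u : J → E} {I : Finset J}
    (hI : I.Nonempty)
    (h : ∀ y : E, (∀ j ∈ I, ⟪u j, y⟫ ≤ 0) → ∀ j ∈ I, ⟪u j, y⟫ = 0) :
    (0 : E) ∈ intrinsicInterior ℝ (convexHull ℝ (u '' (I : Set J))) := by
  obtain ⟨c, hc, hcle⟩ := exists_pos_mul_norm_le_inner hI h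
  set S := Submodule.span ℝ (u '' (I : Set J)) with hS
  set K := convexHull ℝ (u '' (I : Set J)) with hK
  have hKc : IsClosed K := ((I.finite_toSet.image u).isCompact_convexHull ℝ).isClosed
  have hball : ∀ x ∈ S, ‖x‖ < c → x ∈ K := by
    intro x hxS hxc
    by_contra hxK
    obtain ⟨f, b, hfb, hbx⟩ := geometric_hahn_banach_closed_point (convex_convexHull ℝ _) hKc hxK
    set y := (InnerProductSpace.toDual ℝ E).symm f with hy
    have hf : ∀ z, f z = ⟪z, y⟫ := fun z => by
      rw [real_inner_comm, hy, InnerProductSpace.toDual_symm_apply]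
    obtain ⟨j, hj, hle⟩ := hcle (S.starProjection y) (S.starProjection_apply_mem y)
    have h1 : ⟪u j, y⟫ < ⟪x, y⟫ := by
      rw [← hf, ← hf]
      exact (hfb _ (subset_convexHull ℝ _ ⟨j, hj, rfl⟩)).trans hbx
    have huS : u j ∈ S := Submodule.subset_span ⟨j, hj, rfl⟩
    rw [← inner_starProjection_span_eq huS,
      ← inner_starProjection_span_eq hxS] at h1
    have h2 := real_inner_le_norm x (S.starProjection y)
    have h3 := mul_le_mul_of_nonneg_right hxc.le (norm_nonneg (S.starProjection y))
    exact absurd (hle.trans_lt h1) (not_lt.2 (h2.trans h3))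
  have hKS : affineSpan ℝ K ≤ S.toAffineSubspace := by
    rw [hK, affineSpan_convexHull, affineSpan_le]
    exact Submodule.subset_span
  have h0 : (0 : E) ∈ K := hball 0 S.zero_mem (by simpa using hc)
  refine mem_intrinsicInterior.2 ⟨⟨0, subset_affineSpan ℝ K h0⟩, ?_, rfl⟩
  rw [mem_interior_iff_mem_nhds, Metric.mem_nhds_iff]
  refine ⟨c, hc, fun x hx => hball x (hKS x.2) ?_⟩
  rwa [Metric.mem_ball, Subtype.dist_eq, dist_zero_right] at hx

theorem exists_forall_sum_exp_le [FiniteDimensional ℝ E] {u : J → E} {I : Finset J}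
    (hI : I.Nonempty) {d : J → ℝ} (hd : ∀ j ∈ I, 0 < d j)
    (h : ∀ y : E, (∀ j ∈ I, ⟪u j, y⟫ ≤ 0) → ∀ j ∈ I, ⟪u j, y⟫ = 0) :
    ∃ y₀ : E, ∀ y, ∑ j ∈ I, d j * Real.exp ⟪u j, y₀⟫ ≤ ∑ j ∈ I, d j * Real.exp ⟪u j, y⟫ := by
  obtain ⟨c, hc, hcle⟩ := exists_pos_mul_norm_le_inner hI h
  set S := Submodule.span ℝ (u '' (I : Set J)) with hS
  have hcont : Continuous fun y : S => ∑ j ∈ I, d j * Real.exp ⟪u j, (y : E)⟫ := by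
    fun_prop
  obtain ⟨m, hm, hmd⟩ : ∃ m : ℝ, 0 < m ∧ ∀ j ∈ I, m ≤ d j := by
    obtain ⟨i, hi, hmin⟩ := I.exists_min_image d hI
    exact ⟨d i, hd i hi, hmin⟩
  have hlow : ∀ y : S, m * (c * ‖y‖) ≤ ∑ j ∈ I, d j * Real.exp ⟪u j, (y : E)⟫ := by
    intro y
    obtain ⟨j, hj, hle⟩ := hcle y y.2
    calc m * (c * ‖y‖) ≤ d j * Real.exp ⟪u j, (y : E)⟫ := by
          refine mul_le_mul (hmd j hj) ?_ (by positivity) (hd j hj).le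
          exact hle.trans ((le_add_of_nonneg_right zero_le_one).trans (Real.add_one_le_exp _))
      _ ≤ _ := Finset.single_le_sum (f := fun j => d j * Real.exp ⟪u j, (y : E)⟫)
          (fun i hi => (mul_pos (hd i hi) (Real.exp_pos _)).le) hj
  have htend : Filter.Tendsto (fun y : S => ∑ j ∈ I, d j * Real.exp ⟪u j, (y : E)⟫)
      (Filter.cocompact S) Filter.atTop :=
    Filter.tendsto_atTop_mono hlow
      (((tendsto_norm_cocompact_atTop (E := S)).const_mul_atTop hc).const_mul_atTop hm)
  obtain ⟨y₀, hy₀⟩ := hcont.exists_forall_le htend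
  refine ⟨y₀, fun y => (hy₀ ⟨_, S.starProjection_apply_mem y⟩).trans_eq ?_⟩
  refine Finset.sum_congr rfl fun j hj => ?_
  have huS : u j ∈ S := Submodule.subset_span ⟨j, hj, rfl⟩
  rw [inner_starProjection_span_eq huS]

theorem inner_eq_zero_of_forall_sum_exp_le {u : J → E} {I : Finset J} {d : J → ℝ}
    (hd : ∀ j ∈ I, 0 < d j) {y₀ : E}
    (hmin : ∀ y, ∑ j ∈ I, d j * Real.exp ⟪u j, y₀⟫ ≤ ∑ j ∈ I, d j * Real.exp ⟪u j, y⟫)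
    {y : E} (hy : ∀ j ∈ I, ⟪u j, y⟫ ≤ 0) : ∀ j ∈ I, ⟪u j, y⟫ = 0 := by
  by_contra! hne
  obtain ⟨i, hi, hine⟩ := hne
  refine (hmin (y₀ + y)).not_gt (Finset.sum_lt_sum (fun j hj => ?_) ⟨i, hi, ?_⟩)
  · refine mul_le_mul_of_nonneg_left (Real.exp_le_exp.2 ?_) (hd j hj).le
    rw [inner_add_right]
    linarith [hy j hj]
  · refine mul_lt_mul_of_pos_left (Real.exp_lt_exp.2 ?_) (hd i hi)
    rw [inner_add_right]
    linarith [lt_of_le_of_ne (hy i hi) hine]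

theorem iInf_sum_exp_pos {u : J → E} {I : Finset J} (hI : I.Nonempty) {d : J → ℝ}
    (hd : ∀ j ∈ I, 0 < d j) (h0 : (0 : E) ∈ convexHull ℝ (u '' (I : Set J))) :
    0 < ⨅ y : E, ∑ j ∈ I, d j * Real.exp ⟪u j, y⟫ := by
  obtain ⟨i, hi, hmin⟩ := I.exists_min_image d hI
  refine (hd i hi).trans_le (le_ciInf fun y => ?_)
  obtain ⟨j, hj, hle⟩ : ∃ j ∈ I, 0 ≤ ⟪u j, y⟫ := by
    by_contra! hlt
    have hc : Convex ℝ {x : E | ⟪x, y⟫ < 0} :=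
      convex_halfSpace_lt
        ⟨fun a b => inner_add_left a b y, fun c a => real_inner_smul_left a y c⟩ 0
    have hsub : u '' (I : Set J) ⊆ {x : E | ⟪x, y⟫ < 0} := by
      rintro _ ⟨j, hj, rfl⟩
      exact hlt j hj
    simpa using convexHull_min hsub hc h0
  calc d i ≤ d j * Real.exp ⟪u j, y⟫ :=
        (hmin j hj).trans (le_mul_of_one_le_right (hd j hj).le (Real.one_le_exp hle))
    _ ≤ _ := Finset.single_le_sum (f := fun j => d j * Real.exp ⟪u j, y⟫)
        (fun i hi => (mul_pos (hd i hi) (Real.exp_pos _)).le) hj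

theorem iInf_sum_exp_eq_zero [FiniteDimensional ℝ E] {u : J → E} {I : Finset J} {d : J → ℝ}
    (hd : ∀ j ∈ I, 0 < d j) (h0 : (0 : E) ∉ convexHull ℝ (u '' (I : Set J))) :
    ⨅ y : E, ∑ j ∈ I, d j * Real.exp ⟪u j, y⟫ = 0 := by
  have hnonneg : ∀ y : E, 0 ≤ ∑ j ∈ I, d j * Real.exp ⟪u j, y⟫ := fun y =>
    Finset.sum_nonneg fun j hj => (mul_pos (hd j hj) (Real.exp_pos _)).le
  refine le_antisymm ?_ (le_ciInf hnonneg)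
  have hKc : IsClosed (convexHull ℝ (u '' (I : Set J))) :=
    ((I.finite_toSet.image u).isCompact_convexHull ℝ).isClosed
  obtain ⟨f, b, hfb, hbx⟩ := geometric_hahn_banach_closed_point (convex_convexHull ℝ _) hKc h0
  rw [map_zero] at hbx
  set y := (InnerProductSpace.toDual ℝ E).symm f with hy
  have hneg : ∀ j ∈ I, ⟪u j, y⟫ < 0 := fun j hj => by
    rw [real_inner_comm, hy, InnerProductSpace.toDual_symm_apply]
    exact (hfb _ (subset_convexHull ℝ _ ⟨j, hj, rfl⟩)).trans hbx
  have htend : Filter.Tendsto (fun t : ℝ => ∑ j ∈ I, d j * Real.exp ⟪u j, t • y⟫)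
      Filter.atTop (nhds (∑ j ∈ I, d j * 0)) := by
    refine tendsto_finsetSum _ fun j hj => Filter.Tendsto.const_mul _ ?_
    refine Real.tendsto_exp_atBot.comp ?_
    simp only [real_inner_smul_right]
    exact Filter.tendsto_id.atTop_mul_const_of_neg (hneg j hj)
  simp only [mul_zero, Finset.sum_const_zero] at htend
  refine ge_of_tendsto' htend fun t => ciInf_le ⟨0, ?_⟩ (t • y)
  rintro _ ⟨z, rfl⟩
  exact hnonneg z

end ExponentialSums

/-- **Proposition (trichotomy for minimisers of weighted sums of exponentials).**
Let `(u j)_{j ∈ J}` be pairwise distinct vectors in `ℝ^n`, `I` a nonempty subset of `J` and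
`d` a family of strictly positive coefficients on `I`.  With
`f_I(y) = ∑_{j ∈ I} d j * exp ⟪u j, y⟫` and `g_I = inf_y f_I(y)`, and `K(I)` the convex hull
of `{u j : j ∈ I}`:
(i) `0` lies in the relative interior of `K(I)` iff `f_I` attains its infimum and `g_I > 0`;
(ii) `0` lies in the relative boundary of `K(I)` iff `f_I` does not attain its infimum and `g_I > 0`;
(iii) `0 ∉ K(I)` iff `f_I` does not attain its infimum and `g_I = 0`. -/
theorem exponential_trichotomy
    {n : ℕ} {J : Type*} [Fintype J] [DecidableEq J]
    (u : J → EuclideanSpace ℝ (Fin n)) (hu : Function.Injective u)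
    (I : Finset J) (hI : I.Nonempty) (d : J → ℝ) (hd : ∀ j ∈ I, 0 < d j) :
    ((0 : EuclideanSpace ℝ (Fin n)) ∈
        intrinsicInterior ℝ (convexHull ℝ (u '' (I : Set J))) ↔
      ((∃ y₀ : EuclideanSpace ℝ (Fin n), ∀ y,
          (∑ j ∈ I, d j * Real.exp ⟪u j, y₀⟫) ≤ ∑ j ∈ I, d j * Real.exp ⟪u j, y⟫) ∧
        0 < ⨅ y : EuclideanSpace ℝ (Fin n), ∑ j ∈ I, d j * Real.exp ⟪u j, y⟫)) ∧
    ((0 : EuclideanSpace ℝ (Fin n)) ∈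
        intrinsicFrontier ℝ (convexHull ℝ (u '' (I : Set J))) ↔
      ((¬ ∃ y₀ : EuclideanSpace ℝ (Fin n), ∀ y,
          (∑ j ∈ I, d j * Real.exp ⟪u j, y₀⟫) ≤ ∑ j ∈ I, d j * Real.exp ⟪u j, y⟫) ∧
        0 < ⨅ y : EuclideanSpace ℝ (Fin n), ∑ j ∈ I, d j * Real.exp ⟪u j, y⟫)) ∧
    ((0 : EuclideanSpace ℝ (Fin n)) ∉ convexHull ℝ (u '' (I : Set J)) ↔
      ((¬ ∃ y₀ : EuclideanSpace ℝ (Fin n), ∀ y,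
          (∑ j ∈ I, d j * Real.exp ⟪u j, y₀⟫) ≤ ∑ j ∈ I, d j * Real.exp ⟪u j, y⟫) ∧
        (⨅ y : EuclideanSpace ℝ (Fin n), ∑ j ∈ I, d j * Real.exp ⟪u j, y⟫) = 0)) := by
  set K := convexHull ℝ (u '' (I : Set J)) with hK
  have hKc : IsClosed K := ((I.finite_toSet.image u).isCompact_convexHull ℝ).isClosed
  have hint : (0 : EuclideanSpace ℝ (Fin n)) ∈ intrinsicInterior ℝ K ↔
      ∃ y₀ : EuclideanSpace ℝ (Fin n), ∀ y,
        (∑ j ∈ I, d j * Real.exp ⟪u j, y₀⟫) ≤ ∑ j ∈ I, d j * Real.exp ⟪u j, y⟫ := by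
    constructor
    · intro h0
      refine exists_forall_sum_exp_le hI hd fun y hy j hj => ?_
      refine inner_eq_zero_of_zero_mem_intrinsicInterior h0
        (fun x hx => inner_le_of_mem_convexHull ?_ hx) (subset_convexHull ℝ _ ⟨j, hj, rfl⟩)
      rintro _ ⟨i, hi, rfl⟩
      exact hy i hi
    · rintro ⟨y₀, hy₀⟩
      exact zero_mem_intrinsicInterior_convexHull hI fun y hy =>
        inner_eq_zero_of_forall_sum_exp_le hd hy₀ hy
  have hpos : 0 < (⨅ y : EuclideanSpace ℝ (Fin n), ∑ j ∈ I, d j * Real.exp ⟪u j, y⟫) ↔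
      (0 : EuclideanSpace ℝ (Fin n)) ∈ K := by
    refine ⟨fun h => ?_, iInf_sum_exp_pos hI hd⟩
    by_contra h0
    exact h.ne' (iInf_sum_exp_eq_zero hd h0)
  have hzero : (⨅ y : EuclideanSpace ℝ (Fin n), ∑ j ∈ I, d j * Real.exp ⟪u j, y⟫) = 0 ↔
      (0 : EuclideanSpace ℝ (Fin n)) ∉ K :=
    ⟨fun h h0 => (hpos.2 h0).ne' h, iInf_sum_exp_eq_zero hd⟩
  have hsub : (0 : EuclideanSpace ℝ (Fin n)) ∈ intrinsicInterior ℝ K → 0 ∈ K :=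
    fun h => intrinsicInterior_subset h
  rw [← hint, hpos, hzero, ← intrinsicClosure_sdiff_intrinsicInterior,
    intrinsicClosure_eq_closure, hKc.closure_eq, Set.mem_sdiff]
  tauto
end

section
/- Let J be a finite index set and (u_j)_{j∈J} pairwise distinct vectors in ℝ^n. There exists a constant c₁ ∈ (0,1), depending only on (u_j)_{j∈J}, with the following property: for each subset I of J such that 0 is not in the relative interior of K(I), there exist a subset I₁ of I and a unit vector v ∈ ℝ^n such that ⟨v, u_j⟩ = 0 for all j ∈ I₁, ⟨v, u_j⟩ ≥ c₁ for all j ∈ I \ I₁, and either 0 lies in the relative interior of K(I₁), or 0 ∉ K(I) and I₁ = ∅. -/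
open scoped RealInnerProductSpace

/-- A point of the convex hull of a finite indexed family is a convex combination of it. -/
theorem exists_weights_of_mem_convexHull_image {ι E : Type*} [AddCommGroup E] [Module ℝ E]
    (s : Finset ι) (f : ι → E) {x : E} (hx : x ∈ convexHull ℝ (f '' (s : Set ι))) :
    ∃ w : ι → ℝ, (∀ i ∈ s, 0 ≤ w i) ∧ ∑ i ∈ s, w i = 1 ∧ ∑ i ∈ s, w i • f i = x := by
  classical
  refine convexHull_min (t := {x | ∃ w : ι → ℝ, (∀ i ∈ s, 0 ≤ w i) ∧ ∑ i ∈ s, w i = 1 ∧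
    ∑ i ∈ s, w i • f i = x}) ?_ ?_ hx
  · rintro _ ⟨i, hi, rfl⟩
    have hi' : i ∈ s := hi
    refine ⟨fun j => if j = i then 1 else 0, fun j _ => ?_, ?_, ?_⟩
    · dsimp only
      split_ifs <;> norm_num
    · simp [hi']
    · simp [hi', ite_smul]
  · rintro _ ⟨w, hw, hw1, rfl⟩ _ ⟨w', hw', hw1', rfl⟩ a b ha hb hab
    refine ⟨fun i => a * w i + b * w' i, fun i hi => ?_, ?_, ?_⟩
    · have := hw i hi
      have := hw' i hi
      positivity
    · rw [Finset.sum_add_distrib, ← Finset.mul_sum, ← Finset.mul_sum, hw1, hw1']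
      simpa using hab
    · simp only [add_smul, mul_smul, Finset.sum_add_distrib, Finset.smul_sum]

/-- If `0` is a combination of a nonempty finite family with positive coefficients, then it lies
in the relative interior of the convex hull of the family. -/
theorem zero_mem_intrinsicInterior_convexHull_of_pos {ι E : Type*} [NormedAddCommGroup E]
    [NormedSpace ℝ E] {s : Finset ι} (hs : s.Nonempty) {f : ι → E} {w : ι → ℝ}
    (hw : ∀ i ∈ s, 0 < w i) (hsum : ∑ i ∈ s, w i • f i = 0) :
    (0 : E) ∈ intrinsicInterior ℝ (convexHull ℝ (f '' (s : Set ι))) := by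
  set K := convexHull ℝ (f '' (s : Set ι)) with hK
  have hconv : Convex ℝ K := convex_convexHull ℝ _
  have hmem : ∀ i ∈ s, f i ∈ K := fun i hi => subset_convexHull ℝ _ ⟨i, hi, rfl⟩
  have hW : 0 < ∑ i ∈ s, w i := Finset.sum_pos hw hs
  have h0 : (0 : E) ∈ K := by
    have := hconv.centerMass_mem (t := s) (fun i hi => (hw i hi).le) hW hmem
    rwa [Finset.centerMass, hsum, smul_zero] at this
  let T : (s → ℝ) →ₗ[ℝ] E := Fintype.linearCombination ℝ (fun i : s => f i)
  have hT : ∀ x, T x = ∑ i, x i • f i := fun x => Fintype.linearCombination_apply _ _ _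
  have hrange : LinearMap.range T = Submodule.span ℝ (f '' (s : Set ι)) := by
    rw [Fintype.range_linearCombination]
    congr 1
    ext x
    simp
  have hopen : IsOpenMap T.rangeRestrict :=
    LinearMap.isOpenMap_of_finiteDimensional _ T.surjective_rangeRestrict
  let U : Set (s → ℝ) := {x | (∀ i, 0 < x i) ∧ ∑ i, x i < 1}
  have hU : IsOpen U := by
    have h : U = (⋂ i, {x | 0 < x i}) ∩ {x | ∑ i, x i < 1} := by
      ext x
      simp [U]
    rw [h]
    exact (isOpen_iInter_of_finite fun i => isOpen_lt continuous_const (continuous_apply i)).inter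
      (isOpen_lt (by fun_prop) continuous_const)
  obtain ⟨V, hV, hVU⟩ := isOpen_induced_iff.1 (hopen U hU)
  have hVK : ∀ x ∈ V, x ∈ LinearMap.range T → x ∈ K := by
    intro x hxV hx
    have : (⟨x, hx⟩ : LinearMap.range T) ∈ T.rangeRestrict '' U := by
      rw [← hVU]; exact hxV
    obtain ⟨y, ⟨hy, hy1⟩, hyx⟩ := this
    have hyx' : T y = x := congrArg Subtype.val hyx
    rw [← hyx', hT]
    have : Nonempty s := hs.coe_sort
    have hy0 : 0 < ∑ i, y i := Finset.sum_pos (fun i _ => hy i) Finset.univ_nonempty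
    have h := hconv.smul_mem_of_zero_mem h0
      (hconv.centerMass_mem (fun i _ => (hy i).le) hy0 fun i _ => hmem i i.2) ⟨hy0.le, hy1.le⟩
    rwa [Finset.centerMass, smul_inv_smul₀ hy0.ne'] at h
  have h0V : (0 : E) ∈ V := by
    have : (0 : LinearMap.range T) ∈ T.rangeRestrict '' U := by
      refine ⟨fun i => w i / (2 * ∑ i ∈ s, w i), ⟨fun i => ?_, ?_⟩, ?_⟩
      · have := hw i i.2
        positivity
      · rw [Finset.sum_coe_sort s (fun i => w i / (2 * ∑ i ∈ s, w i)), ← Finset.sum_div,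
          div_lt_one (by positivity)]
        linarith
      · apply Subtype.ext
        change T _ = 0
        rw [hT, Finset.sum_coe_sort s (fun i => (w i / (2 * ∑ i ∈ s, w i)) • f i)]
        simp only [div_eq_inv_mul, mul_smul, ← Finset.smul_sum]
        rw [hsum, smul_zero]
    rw [← hVU] at this
    exact this
  rw [mem_intrinsicInterior]
  refine ⟨⟨0, subset_affineSpan ℝ K h0⟩, ?_, rfl⟩
  rw [mem_interior]
  refine ⟨((↑) : affineSpan ℝ K → E) ⁻¹' V, fun x hx => hVK x hx ?_,
    hV.preimage continuous_subtype_val, h0V⟩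
  rw [hrange]
  exact affineSpan_subset_span ((affineSpan_convexHull (𝕜 := ℝ) (f '' (s : Set ι))).le x.2)

/-- A finite set whose convex hull misses a subspace lies strictly on one side of a hyperplane
containing that subspace. -/
theorem exists_mem_orthogonal_forall_inner_pos {E : Type*} [NormedAddCommGroup E]
    [InnerProductSpace ℝ E] [FiniteDimensional ℝ E] (L : Submodule ℝ E) {A : Set E}
    (hA : A.Finite) (hL : ∀ x ∈ convexHull ℝ A, x ∉ L) :
    ∃ v ∈ Lᗮ, ∀ x ∈ A, 0 < ⟪v, x⟫ := by
  let P : E →ₗ[ℝ] E := (Lᗮ.starProjection : E →L[ℝ] E)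
  have h0 : (0 : E) ∉ convexHull ℝ (P '' A) := by
    rw [← P.image_convexHull]
    rintro ⟨x, hx, hPx⟩
    refine hL x hx ?_
    have : x ∈ Lᗮᗮ := (Submodule.starProjection_apply_eq_zero_iff _).1 hPx
    rwa [Submodule.orthogonal_orthogonal] at this
  obtain ⟨g, a, ha, hg⟩ := geometric_hahn_banach_point_closed (convex_convexHull ℝ _)
    ((hA.image P).isClosed_convexHull ℝ) h0
  refine ⟨P ((InnerProductSpace.toDual ℝ E).symm g), Submodule.starProjection_apply_mem _ _,
    fun x hx => ?_⟩
  have h1 : ⟪P ((InnerProductSpace.toDual ℝ E).symm g), x⟫ = g (P x) := by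
    rw [← InnerProductSpace.toDual_symm_apply (𝕜 := ℝ) (x := P x)]
    exact Lᗮ.inner_starProjection_left_eq_right _ _
  rw [h1]
  rw [map_zero] at ha
  exact ha.trans (hg _ (subset_convexHull ℝ _ ⟨x, hx, rfl⟩))

/-- A finite family splits into a part that carries a linear relation with positive coefficients
and a part lying strictly on one side of a hyperplane through the first part; the first part is
empty only if `0` is not in the convex hull of the family. -/
theorem exists_pos_relation_and_separation {ι E : Type*} [NormedAddCommGroup E]
    [InnerProductSpace ℝ E] [FiniteDimensional ℝ E] [DecidableEq ι] (f : ι → E) (s : Finset ι) :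
    ∃ t ⊆ s, ∃ v : E, (∀ i ∈ t, ⟪v, f i⟫ = 0) ∧ (∀ i ∈ s \ t, 0 < ⟪v, f i⟫) ∧
      (∃ w : ι → ℝ, (∀ i ∈ t, 0 < w i) ∧ ∑ i ∈ t, w i • f i = 0) ∧
      (t = ∅ → (0 : E) ∉ convexHull ℝ (f '' (s : Set ι))) := by
  classical
  let R : (ι → ℝ) → Prop := fun w => (∀ i ∈ s, 0 ≤ w i) ∧ ∑ i ∈ s, w i • f i = 0
  let t := s.filter fun j => ∃ w, R w ∧ 0 < w j
  have hts : t ⊆ s := Finset.filter_subset _ _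
  have hmem : ∀ {j}, j ∈ s → ∀ {w}, R w → 0 < w j → j ∈ t := fun hj w hw hwj =>
    Finset.mem_filter.2 ⟨hj, w, hw, hwj⟩
  have hzero : ∀ {j}, j ∈ s → j ∉ t → ∀ {w}, R w → w j = 0 := fun hj hjt w hw =>
    le_antisymm (not_lt.1 fun h => hjt (hmem hj hw h)) (hw.1 _ hj)
  have hrestrict : ∀ {w}, R w → ∑ i ∈ t, w i • f i = 0 := by
    intro w hw
    rw [← hw.2]
    refine Finset.sum_subset hts fun i hi hit => ?_
    rw [hzero hi hit hw, zero_smul]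
  obtain ⟨w, hw, hwpos⟩ : ∃ w, R w ∧ ∀ j ∈ t, 0 < w j := by
    have h : ∀ j, ∃ w, R w ∧ (j ∈ t → 0 < w j) := by
      intro j
      by_cases hj : j ∈ t
      · obtain ⟨w, hw, hwj⟩ := (Finset.mem_filter.1 hj).2
        exact ⟨w, hw, fun _ => hwj⟩
      · exact ⟨0, ⟨by simp, by simp⟩, fun h => absurd h hj⟩
    choose W hW hWpos using h
    refine ⟨fun i => ∑ j ∈ t, W j i, ⟨fun i hi => Finset.sum_nonneg fun j _ => (hW j).1 i hi, ?_⟩,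
      fun j hj => Finset.sum_pos' (fun k _ => (hW k).1 j (hts hj)) ⟨j, hj, hWpos j hj⟩⟩
    simp only [Finset.sum_smul]
    rw [Finset.sum_comm]
    exact Finset.sum_eq_zero fun j _ => (hW j).2
  have hsep : ∀ x ∈ convexHull ℝ (f '' ((s \ t : Finset ι) : Set ι)),
      x ∉ Submodule.span ℝ (f '' (t : Set ι)) := by
    intro x hx hxL
    obtain ⟨m, hm, hm1, hmx⟩ := exists_weights_of_mem_convexHull_image _ f hx
    obtain ⟨c, hc⟩ := (Submodule.mem_span_image_finset_iff_exists_fun' ℝ).1 hxL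
    let a : ℝ := ∑ i ∈ t, |c i| / w i
    have ha : ∀ i ∈ t, c i ≤ a * w i := by
      intro i hi
      have h1 : |c i| / w i ≤ a :=
        Finset.single_le_sum (f := fun i => |c i| / w i)
          (fun k hk => div_nonneg (abs_nonneg _) (hwpos k hk).le) hi
      exact (le_abs_self _).trans ((div_le_iff₀ (hwpos i hi)).1 h1)
    let r : ι → ℝ := fun i => if i ∈ t then a * w i - c i else m i
    have hr : R r := by
      constructor
      · intro i hi
        by_cases hit : i ∈ t
        · simpa [r, hit] using ha i hit
        · simpa [r, hit] using hm i (Finset.mem_sdiff.2 ⟨hi, hit⟩)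
      · rw [← Finset.sum_sdiff hts]
        have h1 : ∑ i ∈ s \ t, r i • f i = x := by
          rw [← hmx]
          refine Finset.sum_congr rfl fun i hi => ?_
          simp [r, (Finset.mem_sdiff.1 hi).2]
        have h2 : ∑ i ∈ t, r i • f i = a • ∑ i ∈ t, w i • f i - x := by
          rw [← hc, Finset.smul_sum, ← Finset.sum_sub_distrib]
          refine Finset.sum_congr rfl fun i hi => ?_
          simp [r, hi, sub_smul, mul_smul]
        rw [h1, h2, hrestrict hw]
        simp
    have hm0 : ∑ i ∈ s \ t, m i = 0 := by
      refine Finset.sum_eq_zero fun i hi => ?_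
      obtain ⟨his, hit⟩ := Finset.mem_sdiff.1 hi
      simpa [r, hit] using hzero his hit hr
    linarith
  obtain ⟨v, hvL, hv⟩ := exists_mem_orthogonal_forall_inner_pos _
    ((s \ t).finite_toSet.image f) hsep
  refine ⟨t, hts, v, fun i hi => ?_, fun i hi => hv _ ⟨i, hi, rfl⟩,
    ⟨w, hwpos, hrestrict hw⟩, fun ht h0 => ?_⟩
  · exact Submodule.inner_left_of_mem_orthogonal
      (Submodule.subset_span (Set.mem_image_of_mem f (Finset.mem_coe.2 hi))) hvL
  · refine hsep 0 ?_ (Submodule.zero_mem _)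
    rwa [ht, Finset.sdiff_empty]

/-- Finitely many reals have a lower bound in `(0, 1)` for those among them that are positive. -/
theorem exists_mem_Ioo_forall_le_of_pos {ι : Type*} [Finite ι] (a : ι → ℝ) :
    ∃ c ∈ Set.Ioo (0 : ℝ) 1, ∀ i, 0 < a i → c ≤ a i := by
  have h : ∀ᶠ c in nhdsWithin (0 : ℝ) (Set.Ioi 0), ∀ i, 0 < a i → c ≤ a i := by
    rw [Filter.eventually_all]
    intro i
    by_cases hi : 0 < a i
    · filter_upwards [Ioo_mem_nhdsGT hi] with c hc _ using hc.2.le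
    · exact Filter.Eventually.of_forall fun c h => absurd h hi
  obtain ⟨c, hc, hc1⟩ := (h.and (Ioo_mem_nhdsGT one_pos)).exists
  exact ⟨c, hc1, hc⟩

/-- **Lemma (uniform separation for faces of the polytopes `K(I)`).**
Let `(u j)_{j ∈ J}` be pairwise distinct vectors in `ℝ^n` (with `n ≥ 1`).  There is a
constant `c₁ ∈ (0,1)`, depending only on `(u j)`, such that for every subset `I ⊆ J` with
`0` not in the relative interior of `K(I) = convexHull {u j : j ∈ I}` there are `I₁ ⊆ I`
and a unit vector `v` with `⟪v, u j⟫ = 0` for `j ∈ I₁`, `⟪v, u j⟫ ≥ c₁` for `j ∈ I \ I₁`,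
and either `0` lies in the relative interior of `K(I₁)`, or `0 ∉ K(I)` and `I₁ = ∅`. -/
theorem uniform_face_separation
    {n : ℕ} (hn : 0 < n) {J : Type*} [Fintype J] [DecidableEq J]
    (u : J → EuclideanSpace ℝ (Fin n)) (hu : Function.Injective u) :
    ∃ c₁ ∈ Set.Ioo (0 : ℝ) 1, ∀ I : Finset J,
      (0 : EuclideanSpace ℝ (Fin n)) ∉
          intrinsicInterior ℝ (convexHull ℝ (u '' (I : Set J))) →
      ∃ I₁ ⊆ I, ∃ v : EuclideanSpace ℝ (Fin n), ‖v‖ = 1 ∧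
        (∀ j ∈ I₁, ⟪v, u j⟫ = 0) ∧
        (∀ j ∈ I \ I₁, c₁ ≤ ⟪v, u j⟫) ∧
        ((0 : EuclideanSpace ℝ (Fin n)) ∈
            intrinsicInterior ℝ (convexHull ℝ (u '' (I₁ : Set J))) ∨
          ((0 : EuclideanSpace ℝ (Fin n)) ∉ convexHull ℝ (u '' (I : Set J)) ∧ I₁ = ∅)) := by
  have hI : ∀ I : Finset J, ∃ I₁ ⊆ I, ∃ v : EuclideanSpace ℝ (Fin n),
      (0 : EuclideanSpace ℝ (Fin n)) ∉
        intrinsicInterior ℝ (convexHull ℝ (u '' (I : Set J))) →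
      ‖v‖ = 1 ∧ (∀ j ∈ I₁, ⟪v, u j⟫ = 0) ∧ (∀ j ∈ I \ I₁, 0 < ⟪v, u j⟫) ∧
        ((0 : EuclideanSpace ℝ (Fin n)) ∈
            intrinsicInterior ℝ (convexHull ℝ (u '' (I₁ : Set J))) ∨
          ((0 : EuclideanSpace ℝ (Fin n)) ∉ convexHull ℝ (u '' (I : Set J)) ∧ I₁ = ∅)) := by
    intro I
    obtain ⟨I₁, hI₁, v, hv0, hvpos, ⟨w, hw, hsum⟩, hempty⟩ :=
      exists_pos_relation_and_separation u I
    have hI₁int : I₁.Nonempty → (0 : EuclideanSpace ℝ (Fin n)) ∈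
        intrinsicInterior ℝ (convexHull ℝ (u '' (I₁ : Set J))) := fun h =>
      zero_mem_intrinsicInterior_convexHull_of_pos h hw hsum
    obtain rfl | hne := I.eq_empty_or_nonempty
    · refine ⟨∅, subset_rfl, EuclideanSpace.single ⟨0, hn⟩ 1, fun _ => ?_⟩
      simp
    refine ⟨I₁, hI₁, ‖v‖⁻¹ • v, fun h0 => ?_⟩
    have hv : v ≠ 0 := by
      rintro rfl
      have hle : I ⊆ I₁ := fun i hi => by
        by_contra hi₁
        simpa using hvpos i (Finset.mem_sdiff.2 ⟨hi, hi₁⟩)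
      obtain rfl := hI₁.antisymm hle
      exact h0 (hI₁int hne)
    have hvn : 0 < ‖v‖⁻¹ := inv_pos.2 (norm_pos_iff.2 hv)
    refine ⟨norm_smul_inv_norm hv, fun j hj => ?_, fun j hj => ?_, ?_⟩
    · rw [real_inner_smul_left, hv0 j hj, mul_zero]
    · rw [real_inner_smul_left]
      exact mul_pos hvn (hvpos j hj)
    · obtain h | h := I₁.eq_empty_or_nonempty
      · exact Or.inr ⟨hempty h, h⟩
      · exact Or.inl (hI₁int h)
  choose F hF v hv using hI
  obtain ⟨c, hc, hle⟩ :=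
    exists_mem_Ioo_forall_le_of_pos fun p : Finset J × J => ⟪v p.1, u p.2⟫
  refine ⟨c, hc, fun I h0 => ⟨F I, hF I, v I, ?_⟩⟩
  obtain ⟨h1, h2, h3, h4⟩ := hv I h0
  exact ⟨h1, h2, fun j hj => hle (I, j) (h3 j hj), h4⟩
end

section
/- Let J be a finite index set and (u_j)_{j∈J} pairwise distinct vectors in ℝ^n. Let c₀ ∈ (0,1) be a constant such that span(K(I)) ∩ B̄(0,c₀) ⊆ K(I) for every subset I of J with 0 in the relative interior of K(I). Then for every nonempty I ⊆ J with 0 in the relative interior of K(I) and every d ∈ (0,1]^I, there exists y ∈ ℝ^n such that f_I(y,d) = g_I(d) and |y| ≤ (1/c₀) · log(|I|/Δ), where Δ = min_{j∈I} d_j. -/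
open scoped RealInnerProductSpace

/-- A linear functional on a convex hull is bounded above by one of its values at the generators. -/
lemma exists_mem_le_inner_of_mem_convexHull {E : Type*} [NormedAddCommGroup E]
    [InnerProductSpace ℝ E] {s : Set E} {x : E} (hx : x ∈ convexHull ℝ s) (y : E) :
    ∃ v ∈ s, ⟪x, y⟫ ≤ ⟪v, y⟫ := by
  by_contra! h
  have hconv : Convex ℝ {v : E | ⟪v, y⟫ < ⟪x, y⟫} :=
    convex_halfSpace_lt
      ⟨fun a b => inner_add_left a b y, fun c a => real_inner_smul_left a y c⟩ _
  have hlt : ⟪x, y⟫ < ⟪x, y⟫ := convexHull_min (fun v hv => h v hv) hconv hx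
  exact lt_irrefl _ hlt

/-- If a convex hull contains `c • (y / ‖y‖)`, then some generator pairs with `y` to at least
`c * ‖y‖`. -/
lemma exists_mem_mul_norm_le_inner {E : Type*} [NormedAddCommGroup E]
    [InnerProductSpace ℝ E] {s : Set E} {S : Submodule ℝ E} {c : ℝ} (hc : 0 ≤ c)
    (h : (S : Set E) ∩ Metric.closedBall 0 c ⊆ convexHull ℝ s) {y : E} (hy : y ∈ S)
    (hy0 : y ≠ 0) : ∃ v ∈ s, c * ‖y‖ ≤ ⟪v, y⟫ := by
  have hn : ‖y‖ ≠ 0 := norm_ne_zero_iff.mpr hy0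
  have hx : (c / ‖y‖) • y ∈ convexHull ℝ s := by
    refine h ⟨S.smul_mem _ hy, ?_⟩
    rw [mem_closedBall_zero_iff, norm_smul, norm_div, norm_norm, Real.norm_of_nonneg hc,
      div_mul_cancel₀ _ hn]
  obtain ⟨v, hv, hle⟩ := exists_mem_le_inner_of_mem_convexHull hx y
  refine ⟨v, hv, le_of_eq_of_le ?_ hle⟩
  rw [real_inner_smul_left, real_inner_self_eq_norm_sq]
  field_simp

/-- **Lemma (bounded minimisers when `0` is in the relative interior of `K(I)`).**
Let `(u j)_{j ∈ J}` be pairwise distinct vectors in `ℝ^n`, and let `c₀ ∈ (0,1)` satisfy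
`span(K(I)) ∩ B̄(0, c₀) ⊆ K(I)` for every `I ⊆ J` with `0` in the relative interior of
`K(I)`.  Then for every nonempty `I ⊆ J` with `0` in the relative interior of `K(I)` and
every `d ∈ (0,1]^I`, there is `y` with `f_I(y,d) = g_I(d)` and
`‖y‖ ≤ (1/c₀) * log(|I|/Δ)` where `Δ = min_{j ∈ I} d j`. -/
theorem bounded_minimiser
    {n : ℕ} {J : Type*} [Fintype J] [DecidableEq J]
    (u : J → EuclideanSpace ℝ (Fin n)) (hu : Function.Injective u)
    (c₀ : ℝ) (hc₀ : c₀ ∈ Set.Ioo (0 : ℝ) 1)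
    (hspan : ∀ I : Finset J,
      (0 : EuclideanSpace ℝ (Fin n)) ∈
          intrinsicInterior ℝ (convexHull ℝ (u '' (I : Set J))) →
      (Submodule.span ℝ (convexHull ℝ (u '' (I : Set J))) :
          Set (EuclideanSpace ℝ (Fin n))) ∩ Metric.closedBall 0 c₀
        ⊆ convexHull ℝ (u '' (I : Set J))) :
    ∀ I : Finset J, ∀ hI : I.Nonempty,
      (0 : EuclideanSpace ℝ (Fin n)) ∈
          intrinsicInterior ℝ (convexHull ℝ (u '' (I : Set J))) →
      ∀ d : J → ℝ, (∀ j ∈ I, d j ∈ Set.Ioc (0 : ℝ) 1) →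
      ∃ y : EuclideanSpace ℝ (Fin n),
        (∑ j ∈ I, d j * Real.exp ⟪u j, y⟫)
            = (⨅ y' : EuclideanSpace ℝ (Fin n), ∑ j ∈ I, d j * Real.exp ⟪u j, y'⟫) ∧
        ‖y‖ ≤ (1 / c₀) * Real.log ((I.card : ℝ) / I.inf' hI d) := by
  intro I hI h0 d hd
  have hsub := hspan I h0
  set S := Submodule.span ℝ (convexHull ℝ (u '' (I : Set J)))
  set Δ := I.inf' hI d
  have hc := hc₀.1
  have hΔpos : 0 < Δ := (Finset.lt_inf'_iff hI).mpr fun j hj => (hd j hj).1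
  have hΔle : ∀ j ∈ I, Δ ≤ d j := fun j hj => Finset.inf'_le d hj
  have hΔone : Δ ≤ 1 := by
    obtain ⟨j, hj⟩ := hI
    exact (hΔle j hj).trans (hd j hj).2
  have hcard : (1 : ℝ) ≤ I.card := by exact_mod_cast hI.card_pos
  set R := (1 / c₀) * Real.log ((I.card : ℝ) / Δ) with hR
  have hquot : 1 ≤ (I.card : ℝ) / Δ := (one_le_div hΔpos).mpr (hΔone.trans hcard)
  have hR0 : 0 ≤ R := mul_nonneg (by positivity) (Real.log_nonneg hquot)
  set f : EuclideanSpace ℝ (Fin n) → ℝ := fun y => ∑ j ∈ I, d j * Real.exp ⟪u j, y⟫ with hf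
  have hf0 : f 0 ≤ I.card := by
    simp only [hf, inner_zero_right, Real.exp_zero, mul_one]
    simpa using Finset.sum_le_sum fun j hj => (hd j hj).2
  have hlarge : ∀ y ∈ S, R < ‖y‖ → f 0 ≤ f y := by
    intro y hy hRy
    obtain ⟨_, ⟨j, hj, rfl⟩, hle⟩ := exists_mem_mul_norm_le_inner hc.le hsub hy
      (norm_pos_iff.mp (hR0.trans_lt hRy))
    have hlog : Real.log ((I.card : ℝ) / Δ) ≤ ⟪u j, y⟫ := by
      refine le_trans ?_ hle
      calc Real.log ((I.card : ℝ) / Δ) = c₀ * R := by rw [hR]; field_simp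
        _ ≤ c₀ * ‖y‖ := by gcongr
    calc f 0 ≤ I.card := hf0
      _ = Δ * ((I.card : ℝ) / Δ) := by field_simp
      _ ≤ d j * Real.exp ⟪u j, y⟫ :=
        mul_le_mul (hΔle j hj) ((Real.log_le_iff_le_exp (by positivity)).mp hlog)
          (by positivity) (hd j hj).1.le
      _ ≤ f y := Finset.single_le_sum (f := fun j => d j * Real.exp ⟪u j, y⟫)
        (fun k hk => mul_nonneg (hd k hk).1.le (Real.exp_pos _).le) hj
  have hproj : ∀ y, f (S.starProjection y) = f y := by
    intro y
    refine Finset.sum_congr rfl fun j hj => ?_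
    have huS : u j ∈ S := Submodule.subset_span (subset_convexHull ℝ _ ⟨j, hj, rfl⟩)
    rw [← Submodule.inner_starProjection_left_eq_right,
      Submodule.starProjection_eq_self_iff.mpr huS]
  have hcompact : IsCompact ((S : Set (EuclideanSpace ℝ (Fin n))) ∩ Metric.closedBall 0 R) :=
    (isCompact_closedBall 0 R).inter_left S.closed_of_finiteDimensional
  have h0mem : (0 : EuclideanSpace ℝ (Fin n)) ∈
      (S : Set (EuclideanSpace ℝ (Fin n))) ∩ Metric.closedBall 0 R :=
    ⟨S.zero_mem, Metric.mem_closedBall_self hR0⟩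
  have hfc : Continuous f := by fun_prop
  obtain ⟨y, ⟨-, hyR⟩, hmin⟩ := hcompact.exists_isMinOn ⟨0, h0mem⟩ hfc.continuousOn
  have hglobal : ∀ z, f y ≤ f z := by
    intro z
    rw [← hproj z]
    have hz : S.starProjection z ∈ S := S.starProjection_apply_mem z
    by_cases hzR : ‖S.starProjection z‖ ≤ R
    · exact hmin ⟨hz, mem_closedBall_zero_iff.mpr hzR⟩
    · exact (hmin h0mem).trans (hlarge _ hz (not_le.mp hzR))
  exact ⟨y, le_antisymm (le_ciInf hglobal)
    (ciInf_le ⟨f y, Set.forall_mem_range.mpr hglobal⟩ y), mem_closedBall_zero_iff.mp hyR⟩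
end

section
/- Let J be a finite index set and (u_j)_{j∈J} pairwise distinct vectors in ℝ^n. There exist C₁ > 0 and δ₁ > 0, depending only on (u_j)_{j∈J}, with the following property: for every nonempty subset I of J, every δ ∈ (0,δ₁) and every d ∈ (0,1]^I, there exists y ∈ ℝ^n such that f_I(y,d) ≤ g_I(d) + δ and |y| ≤ C₁ · log(1/(δΔ)), where Δ = min_{j∈I} d_j. -/
open scoped RealInnerProductSpace

/-- On the span of a finite family, the norm is controlled by the pairings with the family. -/
theorem exists_norm_le_of_mem_span {E ι : Type*} [NormedAddCommGroup E] [InnerProductSpace ℝ E]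
    [FiniteDimensional ℝ E] (u : ι → E) (A : Finset ι) :
    ∃ C > (0 : ℝ), ∀ y ∈ Submodule.span ℝ (u '' A), ∀ M : ℝ, 0 ≤ M →
      (∀ j ∈ A, |⟪u j, y⟫| ≤ M) → ‖y‖ ≤ C * M := by
  let S := Submodule.span ℝ (u '' A)
  let φ : S →ₗ[ℝ] (A → ℝ) := LinearMap.pi fun j => (innerₗ E (u j)).comp S.subtype
  have hφ (y : S) (j : A) : φ y j = ⟪u j, (y : E)⟫ := rfl
  have hker : LinearMap.ker φ = ⊥ := by
    refine LinearMap.ker_eq_bot'.2 fun y hy => ?_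
    have hle : S ≤ LinearMap.ker (innerₗ E (y : E)) := by
      refine Submodule.span_le.2 ?_
      rintro _ ⟨j, hj, rfl⟩
      have h := congrFun hy ⟨j, hj⟩
      rw [hφ] at h
      simpa [real_inner_comm] using h
    have h := hle y.2
    simpa using h
  obtain ⟨K, hK, hanti⟩ := φ.exists_antilipschitzWith hker
  refine ⟨K, hK, fun y hy M hM hbound => ?_⟩
  have h := hanti.le_mul_dist (⟨y, hy⟩ : S) 0
  simp only [map_zero, dist_zero_right] at h
  refine h.trans (mul_le_mul_of_nonneg_left ?_ K.2)
  exact (pi_norm_le_iff_of_nonneg hM).2 fun j => hbound j j.2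

/-- From a feasible point of a system of linear inequalities, moving along a direction orthogonal
to the constraints in `A`, one reaches a feasible point with a further active constraint. -/
theorem exists_feasible_insert_active {E ι : Type*} [NormedAddCommGroup E]
    [InnerProductSpace ℝ E] (u : ι → E) (I : Finset ι) (b : ι → ℝ) {A : Finset ι} {y v : E}
    (hy : ∀ j ∈ I, ⟪u j, y⟫ ≤ b j) (hA : ∀ j ∈ A, ⟪u j, y⟫ = b j)
    (hv : ∀ j ∈ A, ⟪u j, v⟫ = 0) {k : ι} (hk : k ∈ I) (hkv : 0 < ⟪u k, v⟫) :
    ∃ i ∈ I, i ∉ A ∧ ∃ z : E, (∀ j ∈ I, ⟪u j, z⟫ ≤ b j) ∧ (∀ j ∈ A, ⟪u j, z⟫ = b j) ∧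
      ⟪u i, z⟫ = b i := by
  classical
  obtain ⟨i, hi, hmin⟩ := (I.filter fun j => 0 < ⟪u j, v⟫).exists_min_image
    (fun j => (b j - ⟪u j, y⟫) / ⟪u j, v⟫) ⟨k, by simp [hk, hkv]⟩
  obtain ⟨hiI, hiv⟩ := Finset.mem_filter.1 hi
  set t := (b i - ⟪u i, y⟫) / ⟪u i, v⟫ with ht
  have ht0 : 0 ≤ t := div_nonneg (sub_nonneg.2 (hy i hiI)) hiv.le
  have hz (j : ι) : ⟪u j, y + t • v⟫ = ⟪u j, y⟫ + t * ⟪u j, v⟫ := by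
    rw [inner_add_right, real_inner_smul_right]
  refine ⟨i, hiI, fun h => hiv.ne' (hv i h), y + t • v, fun j hj => ?_, fun j hj => ?_, ?_⟩
  · rw [hz]
    rcases lt_or_ge 0 ⟪u j, v⟫ with hpos | hneg
    · have h := hmin j (Finset.mem_filter.2 ⟨hj, hpos⟩)
      rw [le_div_iff₀ hpos] at h
      linarith
    · linarith [hy j hj, mul_nonpos_of_nonneg_of_nonpos ht0 hneg]
  · rw [hz, hA j hj, hv j hj]
    simp
  · rw [hz, ht, div_mul_cancel₀ _ hiv.ne']
    ring

/-- A feasible system of linear inequalities has a feasible point at which the active constraints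
span all constraints. -/
theorem exists_feasible_span_active {E ι : Type*} [NormedAddCommGroup E]
    [InnerProductSpace ℝ E] [FiniteDimensional ℝ E] (u : ι → E) (I : Finset ι) (b : ι → ℝ)
    (h : ∃ y : E, ∀ j ∈ I, ⟪u j, y⟫ ≤ b j) :
    ∃ A ⊆ I, (∀ j ∈ I, u j ∈ Submodule.span ℝ (u '' A)) ∧
      ∃ y : E, (∀ j ∈ I, ⟪u j, y⟫ ≤ b j) ∧ ∀ j ∈ A, ⟪u j, y⟫ = b j := by
  classical
  obtain ⟨y₀, hy₀⟩ := h
  obtain ⟨A, hAmem, hmax⟩ := (I.powerset.filter fun A =>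
    ∃ y : E, (∀ j ∈ I, ⟪u j, y⟫ ≤ b j) ∧ ∀ j ∈ A, ⟪u j, y⟫ = b j).exists_max_image
    Finset.card ⟨∅, by simpa using ⟨y₀, hy₀⟩⟩
  obtain ⟨hAI, y, hy, hyA⟩ := Finset.mem_filter.1 hAmem
  rw [Finset.mem_powerset] at hAI
  refine ⟨A, hAI, fun k hk => ?_, y, hy, hyA⟩
  by_contra hkS
  set S := Submodule.span ℝ (u '' A)
  set v := u k - S.starProjection (u k) with hvdef
  have hvS : ∀ w ∈ S, ⟪w, v⟫ = 0 :=
    (Submodule.mem_orthogonal S v).1 (Submodule.sub_starProjection_mem_orthogonal (u k))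
  have hv0 : v ≠ 0 := fun h0 => hkS <| by
    rw [sub_eq_zero.1 h0]
    exact Submodule.starProjection_apply_mem S (u k)
  have hkv : 0 < ⟪u k, v⟫ := by
    have huk : u k = v + S.starProjection (u k) := by rw [hvdef]; abel
    have hPv := hvS _ (Submodule.starProjection_apply_mem S (u k))
    rw [huk, inner_add_left, hPv, add_zero]
    exact real_inner_self_pos.2 hv0
  obtain ⟨i, hiI, hiA, z, hz, hzA, hzi⟩ := exists_feasible_insert_active u I b hy hyA
    (fun j hj => hvS _ (Submodule.subset_span ⟨j, hj, rfl⟩)) hk hkv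
  have hcard := hmax (insert i A) (Finset.mem_filter.2
    ⟨Finset.mem_powerset.2 (Finset.insert_subset hiI hAI), z, hz, by
      simpa [hzi] using hzA⟩)
  rw [Finset.card_insert_of_notMem hiA] at hcard
  omega

/-- Feasible systems of linear inequalities with normals among finitely many vectors have solutions
whose norm is bounded linearly in terms of the right-hand side. -/
theorem exists_feasible_norm_le {E ι : Type*} [NormedAddCommGroup E]
    [InnerProductSpace ℝ E] [FiniteDimensional ℝ E] [Finite ι] (u : ι → E) :
    ∃ C > (0 : ℝ), ∀ (I : Finset ι) (b : ι → ℝ) (M : ℝ), 0 ≤ M → (∀ j ∈ I, |b j| ≤ M) →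
      (∃ y : E, ∀ j ∈ I, ⟪u j, y⟫ ≤ b j) →
      ∃ y : E, (∀ j ∈ I, ⟪u j, y⟫ ≤ b j) ∧ ‖y‖ ≤ C * M := by
  choose c hc hcb using exists_norm_le_of_mem_span u
  obtain ⟨C, hC⟩ := (Set.finite_range c).bddAbove
  have hcC (A : Finset ι) : c A ≤ C := hC ⟨A, rfl⟩
  refine ⟨C, (hc ∅).trans_le (hcC ∅), fun I b M hM hb h => ?_⟩
  obtain ⟨A, hAI, hspan, y, hy, hyA⟩ := exists_feasible_span_active u I b h
  set S := Submodule.span ℝ (u '' A)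
  have hproj (w : E) (hw : w ∈ S) : ⟪w, S.starProjection y⟫ = ⟪w, y⟫ := by
    have h0 := (Submodule.mem_orthogonal S _).1
      (Submodule.sub_starProjection_mem_orthogonal (K := S) y) w hw
    rw [inner_sub_right] at h0
    linarith
  refine ⟨S.starProjection y, fun j hj => ?_, ?_⟩
  · rw [hproj _ (hspan j hj)]
    exact hy j hj
  · refine (hcb A _ (Submodule.starProjection_apply_mem S y) M hM fun j hj => ?_).trans
      (mul_le_mul_of_nonneg_right (hcC A) hM)
    rw [hproj _ (hspan j (hAI hj)), hyA j hj]
    exact hb j (hAI hj)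

/-- **Lemma (bounded near-minimisers).**
Let `(u j)_{j ∈ J}` be pairwise distinct vectors in `ℝ^n`.  There exist `C₁ > 0` and
`δ₁ > 0`, depending only on `(u j)`, such that for every nonempty `I ⊆ J`, every
`δ ∈ (0,δ₁)` and every `d ∈ (0,1]^I`, there is `y` with
`f_I(y,d) ≤ g_I(d) + δ` and `‖y‖ ≤ C₁ * log(1/(δΔ))` where `Δ = min_{j ∈ I} d j`. -/
theorem bounded_near_minimiser
    {n : ℕ} {J : Type*} [Fintype J] [DecidableEq J]
    (u : J → EuclideanSpace ℝ (Fin n)) (hu : Function.Injective u) :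
    ∃ C₁ > (0 : ℝ), ∃ δ₁ > (0 : ℝ), ∀ I : Finset J, ∀ hI : I.Nonempty,
      ∀ δ ∈ Set.Ioo (0 : ℝ) δ₁, ∀ d : J → ℝ, (∀ j ∈ I, d j ∈ Set.Ioc (0 : ℝ) 1) →
      ∃ y : EuclideanSpace ℝ (Fin n),
        (∑ j ∈ I, d j * Real.exp ⟪u j, y⟫)
            ≤ (⨅ y' : EuclideanSpace ℝ (Fin n), ∑ j ∈ I, d j * Real.exp ⟪u j, y'⟫) + δ ∧
        ‖y‖ ≤ C₁ * Real.log (1 / (δ * I.inf' hI d)) := by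
  obtain ⟨C, hC, hfeas⟩ := exists_feasible_norm_le u
  obtain ⟨N, hN⟩ : ∃ N : ℝ, N = Fintype.card J := ⟨_, rfl⟩
  have hN0 : 0 ≤ N := hN ▸ Nat.cast_nonneg _
  refine ⟨2 * C, by positivity, 1 / (2 * (N + 1)), by positivity, fun I hI δ hδ d hd => ?_⟩
  obtain ⟨hδ0, hδ1⟩ := hδ
  set Δ := I.inf' hI d
  have hΔ0 : 0 < Δ := (Finset.lt_inf'_iff hI).2 fun j hj => (hd j hj).1
  have hΔle (j : J) (hj : j ∈ I) : Δ ≤ d j := Finset.inf'_le d hj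
  have hΔ1 : Δ ≤ 1 := by
    obtain ⟨j, hj⟩ := hI
    exact (hΔle j hj).trans (hd j hj).2
  have hIN : (I.card : ℝ) ≤ N := hN ▸ by exact_mod_cast I.card_le_univ
  have hδN : δ * (2 * (N + 1)) < 1 := (lt_div_iff₀ (by positivity)).1 hδ1
  have hδ1 : δ < 1 := by nlinarith
  set f : EuclideanSpace ℝ (Fin n) → ℝ := fun y => ∑ j ∈ I, d j * Real.exp ⟪u j, y⟫ with hf
  have hterm (y : EuclideanSpace ℝ (Fin n)) (j : J) (hj : j ∈ I) :
      0 ≤ d j * Real.exp ⟪u j, y⟫ := mul_nonneg (hd j hj).1.le (Real.exp_pos _).le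
  have hbdd : BddBelow (Set.range f) :=
    ⟨0, Set.forall_mem_range.2 fun y => Finset.sum_nonneg (hterm y)⟩
  obtain ⟨y', hy'⟩ := exists_lt_of_ciInf_lt (lt_add_of_pos_right (⨅ y, f y) (half_pos hδ0))
  have hf0 : f 0 ≤ N := by
    calc f 0 ≤ ∑ j ∈ I, (1 : ℝ) := Finset.sum_le_sum fun j hj => by simpa using (hd j hj).2
      _ ≤ N := by simpa using hIN
  have hfy' : f y' ≤ N + 1 := by linarith [ciInf_le hbdd 0]
  set L := Real.log (1 / (δ * Δ))
  set L' := Real.log (2 * (N + 1) * (1 / (δ * Δ))) with hL'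
  have hexpL' : Real.exp L' = 2 * (N + 1) * (1 / (δ * Δ)) := Real.exp_log (by positivity)
  have hNL : 2 * (N + 1) ≤ 1 / (δ * Δ) := by
    rw [le_div_iff₀ (by positivity)]
    nlinarith [mul_le_mul_of_nonneg_left hΔ1 (by positivity : 0 ≤ δ * (2 * (N + 1)))]
  have hL'L : L' ≤ 2 * L := by
    rw [hL', Real.log_mul (by positivity) (by positivity)]
    linarith [Real.log_le_log (by positivity) hNL]
  have hL'0 : 0 ≤ L' := Real.log_nonneg (by nlinarith)
  have ha (j : J) (hj : j ∈ I) : ⟪u j, y'⟫ ≤ L' := by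
    rw [← Real.exp_le_exp, hexpL', mul_one_div, le_div_iff₀ (by positivity)]
    have h1 : d j * Real.exp ⟪u j, y'⟫ ≤ f y' :=
      Finset.single_le_sum (f := fun j => d j * Real.exp ⟪u j, y'⟫) (hterm y') hj
    have h2 : δ * Δ ≤ d j := (mul_le_of_le_one_left hΔ0.le hδ1.le).trans (hΔle j hj)
    nlinarith [mul_le_mul_of_nonneg_left h2 (Real.exp_pos ⟪u j, y'⟫).le]
  obtain ⟨y, hy, hynorm⟩ := hfeas I (fun j => max ⟪u j, y'⟫ (-L')) L' hL'0
    (fun j hj => abs_le.2 ⟨le_max_right _ _, max_le (ha j hj) (by linarith)⟩)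
    ⟨y', fun j _ => le_max_left _ _⟩
  refine ⟨y, ?_, hynorm.trans ?_⟩
  · have hsum : f y ≤ f y' + N * Real.exp (-L') := by
      calc f y ≤ ∑ j ∈ I, (d j * Real.exp ⟪u j, y'⟫ + Real.exp (-L')) := by
            refine Finset.sum_le_sum fun j hj => ?_
            have hexp : Real.exp ⟪u j, y⟫ ≤ Real.exp ⟪u j, y'⟫ + Real.exp (-L') := by
              refine (Real.exp_le_exp.2 (hy j hj)).trans ?_
              rw [Real.exp_monotone.map_max]
              exact max_le_add_of_nonneg (Real.exp_pos _).le (Real.exp_pos _).le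
            have h1 := mul_le_mul_of_nonneg_left hexp (hd j hj).1.le
            have h2 := mul_le_of_le_one_left (Real.exp_pos (-L')).le (hd j hj).2
            linarith
        _ = f y' + I.card * Real.exp (-L') := by simp [hf, Finset.sum_add_distrib]
        _ ≤ f y' + N * Real.exp (-L') := by gcongr
    have hsmall : N * Real.exp (-L') ≤ δ / 2 := by
      rw [Real.exp_neg, hexpL', ← div_eq_mul_inv, div_le_iff₀ (by positivity)]
      have : δ / 2 * (2 * (N + 1) * (1 / (δ * Δ))) = (N + 1) / Δ := by field_simp
      rw [this, le_div_iff₀ hΔ0]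
      nlinarith
    change f y ≤ (⨅ y, f y) + δ
    linarith
  · calc C * L' ≤ C * (2 * L) := by gcongr
      _ = 2 * C * L := by ring
end

section
/- Let J be a finite index set and (u_j)_{j∈J} pairwise distinct vectors in ℝ^n. There exist α ∈ (0,1) and δ₀ > 0, depending only on (u_j)_{j∈J}, such that for every D > 0, every I ⊆ J and all d, d' ∈ [0,D]^I, |g_I(d) − g_I(d')| ≤ (D + |J| + 2D|J|δ₀^{-1}) · ‖d − d'‖_∞^α. -/
open scoped RealInnerProductSpace

section LinearInequalities

variable {E J : Type*} [NormedAddCommGroup E] [InnerProductSpace ℝ E]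

/-- If a finite system `⟪u j, x⟫ ≤ c j` is feasible and `c` is not nonnegative, then shrinking a
solution towards the origin gives a solution with an active constraint. -/
lemma exists_feasible_active {u : J → E} {A : Finset J} {c : J → ℝ} {x : E}
    (hx : ∀ j ∈ A, ⟪u j, x⟫ ≤ c j) (hc : ∃ j ∈ A, c j < 0) :
    ∃ x' : E, (∀ j ∈ A, ⟪u j, x'⟫ ≤ c j) ∧ ∃ j ∈ A, u j ≠ 0 ∧ ⟪u j, x'⟫ = c j := by
  classical
  obtain ⟨j₀, hj₀, hj₀c⟩ := hc
  have hV : (A.filter (fun j => c j < 0)).Nonempty := ⟨j₀, by simp [hj₀, hj₀c]⟩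
  obtain ⟨k, hk, hmax⟩ := Finset.exists_max_image _ (fun j => c j / ⟪u j, x⟫) hV
  simp only [Finset.mem_filter] at hk hmax
  obtain ⟨hkA, hkc⟩ := hk
  have hkx : ⟪u k, x⟫ < 0 := (hx k hkA).trans_lt hkc
  have ht0 : 0 ≤ c k / ⟪u k, x⟫ := (div_pos_of_neg_of_neg hkc hkx).le
  have ht1 : c k / ⟪u k, x⟫ ≤ 1 := (div_le_one_of_neg hkx).2 (hx k hkA)
  refine ⟨(c k / ⟪u k, x⟫) • x, fun j hj => ?_, k, hkA, ?_, ?_⟩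
  · rw [inner_smul_right]
    by_cases hjc : c j < 0
    · have hjx : ⟪u j, x⟫ < 0 := (hx j hj).trans_lt hjc
      calc c k / ⟪u k, x⟫ * ⟪u j, x⟫ ≤ c j / ⟪u j, x⟫ * ⟪u j, x⟫ :=
            mul_le_mul_of_nonpos_right (hmax j ⟨hj, hjc⟩) hjx.le
        _ = c j := div_mul_cancel₀ _ hjx.ne
    · have h1 := hx j hj
      rcases le_or_gt ⟪u j, x⟫ 0 with h | h
      · exact (mul_nonpos_of_nonneg_of_nonpos ht0 h).trans (not_lt.1 hjc)
      · exact (mul_le_of_le_one_left h.le ht1).trans h1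
  · rintro h
    simp [h] at hkx
  · rw [inner_smul_right, div_mul_cancel₀ _ hkx.ne]

/-- A weak form of Hoffman's lemma: a feasible finite system of linear inequalities has a solution
whose norm is controlled by the size of the right-hand side. -/
lemma exists_feasible_norm_le_s12 (A : Finset J) (u : J → E) :
    ∃ H : ℝ, 0 ≤ H ∧ ∀ (c : J → ℝ) (M : ℝ), 0 ≤ M → (∀ j ∈ A, |c j| ≤ M) →
      (∃ x : E, ∀ j ∈ A, ⟪u j, x⟫ ≤ c j) →
      ∃ z : E, (∀ j ∈ A, ⟪u j, z⟫ ≤ c j) ∧ ‖z‖ ≤ H * M := by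
  classical
  induction A using Finset.strongInduction generalizing u with
  | H A ih =>
    have key : ∀ j : J, ∃ C : ℝ, 0 ≤ C ∧ (j ∈ A → u j ≠ 0 → ∀ (c : J → ℝ) (M : ℝ), 0 ≤ M →
        (∀ i ∈ A, |c i| ≤ M) → ∀ x : E, (∀ i ∈ A, ⟪u i, x⟫ ≤ c i) → ⟪u j, x⟫ = c j →
        ∃ z : E, (∀ i ∈ A, ⟪u i, z⟫ ≤ c i) ∧ ‖z‖ ≤ C * M) := by
      intro j
      by_cases hj : j ∈ A
      swap
      · exact ⟨0, le_rfl, fun h => absurd h hj⟩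
      by_cases huj : u j = 0
      · exact ⟨0, le_rfl, fun _ h => absurd huj h⟩
      set q : J → ℝ := fun i => ⟪u i, u j⟫ / ⟪u j, u j⟫ with hq
      obtain ⟨H, hH0, hH⟩ := ih (A.erase j) (Finset.erase_ssubset hj)
        (fun i => u i - q i • u j)
      have hS : 0 ≤ ∑ i ∈ A, |q i| := Finset.sum_nonneg fun i _ => abs_nonneg _
      have hn : 0 < ‖u j‖ := norm_pos_iff.2 huj
      have hnn : ⟪u j, u j⟫ ≠ 0 := inner_self_ne_zero.2 huj
      refine ⟨2 * (H * (1 + ∑ i ∈ A, |q i|)) + 1 / ‖u j‖, by positivity, ?_⟩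
      intro _ _ c M hM hcM x hx hxj
      obtain ⟨w, hw, hwn⟩ := hH (fun i => c i - q i * c j) (M * (1 + ∑ i ∈ A, |q i|))
        (by positivity)
        (by
          intro i hi
          have hiA := Finset.mem_of_mem_erase hi
          have h1 : |q i| ≤ ∑ i ∈ A, |q i| :=
            Finset.single_le_sum (f := fun i => |q i|) (fun i _ => abs_nonneg _) hiA
          calc |c i - q i * c j| ≤ |c i| + |q i * c j| := abs_sub _ _
            _ = |c i| + |q i| * |c j| := by rw [abs_mul]
            _ ≤ M + (∑ i ∈ A, |q i|) * M :=
              add_le_add (hcM i hiA) (mul_le_mul h1 (hcM j hj) (abs_nonneg _) hS)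
            _ = M * (1 + ∑ i ∈ A, |q i|) := by ring)
        ⟨x, fun i hi => by
          rw [inner_sub_left, real_inner_smul_left, hxj]
          linarith [hx i (Finset.mem_of_mem_erase hi)]⟩
      refine ⟨w + ((c j - ⟪u j, w⟫) / ⟪u j, u j⟫) • u j, fun i hi => ?_, ?_⟩
      · rw [inner_add_right, inner_smul_right]
        by_cases hij : i = j
        · subst hij
          rw [div_mul_cancel₀ _ hnn]
          linarith
        · have h1 := hw i (Finset.mem_erase.2 ⟨hij, hi⟩)
          rw [inner_sub_left, real_inner_smul_left] at h1
          have h2 : (c j - ⟪u j, w⟫) / ⟪u j, u j⟫ * ⟪u i, u j⟫ = q i * (c j - ⟪u j, w⟫) := by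
            simp only [hq]
            ring
          rw [h2]
          linarith
      · have h1 : |c j - ⟪u j, w⟫| ≤ M + ‖u j‖ * ‖w‖ :=
          (abs_sub _ _).trans (add_le_add (hcM j hj) (abs_real_inner_le_norm _ _))
        have h2 : ‖((c j - ⟪u j, w⟫) / ⟪u j, u j⟫) • u j‖ ≤ M / ‖u j‖ + ‖w‖ := by
          rw [norm_smul, Real.norm_eq_abs, abs_div, real_inner_self_eq_norm_sq,
            abs_of_nonneg (sq_nonneg ‖u j‖)]
          calc |c j - ⟪u j, w⟫| / ‖u j‖ ^ 2 * ‖u j‖ = |c j - ⟪u j, w⟫| / ‖u j‖ := by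
                field_simp
            _ ≤ (M + ‖u j‖ * ‖w‖) / ‖u j‖ := by gcongr
            _ = M / ‖u j‖ + ‖w‖ := by field_simp
        calc ‖w + ((c j - ⟪u j, w⟫) / ⟪u j, u j⟫) • u j‖
            ≤ ‖w‖ + (M / ‖u j‖ + ‖w‖) := (norm_add_le _ _).trans (by gcongr)
          _ ≤ 2 * (H * (M * (1 + ∑ i ∈ A, |q i|))) + M / ‖u j‖ := by linarith
          _ = (2 * (H * (1 + ∑ i ∈ A, |q i|)) + 1 / ‖u j‖) * M := by ring
    choose C hC0 hC using key
    refine ⟨∑ j ∈ A, C j, Finset.sum_nonneg fun j _ => hC0 j, fun c M hM hcM ⟨x, hx⟩ => ?_⟩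
    have hS : 0 ≤ ∑ j ∈ A, C j := Finset.sum_nonneg fun j _ => hC0 j
    by_cases hneg : ∃ j ∈ A, c j < 0
    · obtain ⟨x', hx', j, hj, huj, hact⟩ := exists_feasible_active hx hneg
      obtain ⟨z, hz, hzn⟩ := hC j hj huj c M hM hcM x' hx' hact
      exact ⟨z, hz, hzn.trans (mul_le_mul_of_nonneg_right
        (Finset.single_le_sum (fun i _ => hC0 i) hj) hM)⟩
    · push Not at hneg
      exact ⟨0, fun j hj => by simpa using hneg j hj, by simpa using mul_nonneg hS hM⟩

/-- Any point `y` can be replaced by a point `z` at which all the linear forms `⟪u j, ·⟫` are at most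
`K * r`, without increasing any of them beyond `max ⟪u j, y⟫ (-r)`. -/
lemma exists_inner_le_mul_and_le_max [Fintype J] (u : J → E) :
    ∃ K : ℝ, 1 ≤ K ∧ ∀ (y : E) (r : ℝ), 0 < r →
      ∃ z : E, ∀ j, ⟪u j, z⟫ ≤ K * r ∧ ⟪u j, z⟫ ≤ max ⟪u j, y⟫ (-r) := by
  classical
  choose H hH0 hH using fun A : Finset J => exists_feasible_norm_le_s12 A u
  set Q : ℝ := 1 + (∑ j, ‖u j‖) * ∑ A, H A with hQ
  have hU : 0 ≤ ∑ j, ‖u j‖ := Finset.sum_nonneg fun _ _ => norm_nonneg _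
  have hHs : 0 ≤ ∑ A, H A := Finset.sum_nonneg fun A _ => hH0 A
  have hQ1 : 1 ≤ Q := le_add_of_nonneg_right (mul_nonneg hU hHs)
  have key : ∀ (y : E) (r : ℝ), 0 < r → ∀ (m : ℕ) (T : ℝ), r ≤ T →
      (Finset.univ.filter fun j => T < ⟪u j, y⟫).card ≤ m →
      ∃ z : E, ∀ j, ⟪u j, z⟫ ≤ Q ^ (m + 1) * T ∧ ⟪u j, z⟫ ≤ max ⟪u j, y⟫ (-r) := by
    intro y r hr m
    induction m with
    | zero =>
      intro T hrT hcard
      have hT : 0 < T := hr.trans_le hrT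
      have hall : ∀ j, ⟪u j, y⟫ ≤ T := by
        intro j
        have := Finset.filter_eq_empty_iff.1 (Finset.card_eq_zero.1 (Nat.le_zero.1 hcard))
          (Finset.mem_univ j)
        exact not_lt.1 this
      refine ⟨y, fun j => ⟨?_, le_max_left _ _⟩⟩
      rw [zero_add, pow_one]
      exact (hall j).trans (le_mul_of_one_le_left hT.le hQ1)
    | succ m ihm =>
      intro T hrT hcard
      have hT : 0 < T := hr.trans_le hrT
      have hTQ : T ≤ Q * T := le_mul_of_one_le_left hT.le hQ1
      by_cases hgap : ∃ j, T < ⟪u j, y⟫ ∧ ⟪u j, y⟫ ≤ Q * T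
      · obtain ⟨k, hk1, hk2⟩ := hgap
        obtain ⟨z, hz⟩ := ihm (Q * T) (hrT.trans hTQ) (by
          have : (Finset.univ.filter fun j => Q * T < ⟪u j, y⟫) ⊂
              Finset.univ.filter fun j => T < ⟪u j, y⟫ := by
            refine (Finset.ssubset_iff_of_subset fun j hj => ?_).2 ⟨k, by simpa, by simpa⟩
            simp only [Finset.mem_filter, Finset.mem_univ, true_and] at hj ⊢
            exact hTQ.trans_lt hj
          have := Finset.card_lt_card this
          omega)
        refine ⟨z, fun j => ⟨(hz j).1.trans_eq (by ring), (hz j).2⟩⟩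
      · push Not at hgap
        set A : Finset J := Finset.univ.filter fun j => ⟪u j, y⟫ ≤ T with hA
        obtain ⟨z, hz, hzn⟩ := hH A (fun j => max ⟪u j, y⟫ (-r)) T hT.le
          (by
            intro j hj
            have hjT : ⟪u j, y⟫ ≤ T := (Finset.mem_filter.1 hj).2
            refine abs_le.2 ⟨?_, max_le hjT (by linarith)⟩
            exact (neg_le_neg hrT).trans (le_max_right _ _))
          ⟨y, fun j _ => le_max_left _ _⟩
        have hbd : ∀ j, ⟪u j, z⟫ ≤ Q * T := by
          intro j
          calc ⟪u j, z⟫ ≤ ‖u j‖ * ‖z‖ := real_inner_le_norm _ _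
            _ ≤ (∑ j, ‖u j‖) * ((∑ A, H A) * T) := by
              refine mul_le_mul ?_ (hzn.trans (mul_le_mul_of_nonneg_right ?_ hT.le))
                (norm_nonneg _) hU
              · exact Finset.single_le_sum (f := fun j => ‖u j‖) (fun _ _ => norm_nonneg _)
                  (Finset.mem_univ j)
              · exact Finset.single_le_sum (fun A _ => hH0 A) (Finset.mem_univ A)
            _ ≤ Q * T := by
              rw [hQ]
              linarith
        refine ⟨z, fun j => ⟨(hbd j).trans ?_, ?_⟩⟩
        · refine mul_le_mul_of_nonneg_right ?_ hT.le
          exact le_self_pow₀ hQ1 (by omega)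
        · by_cases hj : ⟪u j, y⟫ ≤ T
          · exact hz j (by simp [hA, hj])
          · exact (hbd j).trans ((hgap j (not_le.1 hj)).le.trans (le_max_left _ _))
  refine ⟨Q ^ (Fintype.card J + 1), one_le_pow₀ hQ1, fun y r hr => ?_⟩
  exact key y r hr _ r le_rfl (Finset.card_le_univ _)

end LinearInequalities

section ExponentialSums

variable {E J : Type*} [NormedAddCommGroup E] [InnerProductSpace ℝ E]

lemma expSum_nonneg (u : J → E) {I : Finset J} {d : J → ℝ} (hd : ∀ j ∈ I, 0 ≤ d j) (y : E) :
    0 ≤ ∑ j ∈ I, d j * Real.exp ⟪u j, y⟫ :=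
  Finset.sum_nonneg fun j hj => mul_nonneg (hd j hj) (Real.exp_pos _).le

lemma iInf_expSum_le (u : J → E) {I : Finset J} {d : J → ℝ} (hd : ∀ j ∈ I, 0 ≤ d j) (y : E) :
    (⨅ y : E, ∑ j ∈ I, d j * Real.exp ⟪u j, y⟫) ≤ ∑ j ∈ I, d j * Real.exp ⟪u j, y⟫ :=
  ciInf_le ⟨0, Set.forall_mem_range.2 (expSum_nonneg u hd)⟩ y

lemma iInf_expSum_le_add [Fintype J] {u : J → E} {K : ℝ} (hK1 : 1 ≤ K)
    (hK : ∀ (y : E) (r : ℝ), 0 < r →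
      ∃ z : E, ∀ j, ⟪u j, z⟫ ≤ K * r ∧ ⟪u j, z⟫ ≤ max ⟪u j, y⟫ (-r))
    {D : ℝ} (hD : 0 ≤ D) {I : Finset J} {d d' : J → ℝ} (hd : ∀ j ∈ I, d j ∈ Set.Icc 0 D)
    (hd' : ∀ j ∈ I, d' j ∈ Set.Icc 0 D) {ε : ℝ} (hε : 0 < ε)
    (hdist : ∀ j ∈ I, d j ≤ d' j + ε) :
    (⨅ y : E, ∑ j ∈ I, d j * Real.exp ⟪u j, y⟫) ≤
      (⨅ y : E, ∑ j ∈ I, d' j * Real.exp ⟪u j, y⟫) +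
        (D + 1) * Fintype.card J * ε ^ (K + 1)⁻¹ := by
  have hcardI : (I.card : ℝ) ≤ Fintype.card J := by exact_mod_cast I.card_le_univ
  have hα : 0 < (K + 1)⁻¹ := by positivity
  have hs : 0 < ε ^ (K + 1)⁻¹ := Real.rpow_pos_of_pos hε _
  have h0 : ∀ j ∈ I, 0 ≤ d j := fun j hj => (hd j hj).1
  rw [← sub_le_iff_le_add]
  refine le_ciInf fun y => ?_
  rw [sub_le_iff_le_add]
  rcases lt_or_ge ε 1 with hε1 | hε1
  · have hlog : Real.log ε < 0 := Real.log_neg hε hε1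
    obtain ⟨z, hz⟩ := hK y (-(Real.log ε * (K + 1)⁻¹))
      (neg_pos.2 (mul_neg_of_neg_of_pos hlog hα))
    have hpow : ε ^ (K + 1)⁻¹ = Real.exp (Real.log ε * (K + 1)⁻¹) := Real.rpow_def_of_pos hε _
    have hbig : ∀ j, ε * Real.exp ⟪u j, z⟫ ≤ ε ^ (K + 1)⁻¹ := by
      intro j
      calc ε * Real.exp ⟪u j, z⟫ = Real.exp (Real.log ε + ⟪u j, z⟫) := by
            rw [Real.exp_add, Real.exp_log hε]
        _ ≤ Real.exp (Real.log ε * (K + 1)⁻¹) := by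
            refine Real.exp_le_exp.2 ((add_le_add_right (hz j).1 _).trans_eq ?_)
            field_simp
            ring
        _ = ε ^ (K + 1)⁻¹ := hpow.symm
    have hsmall : ∀ j, Real.exp ⟪u j, z⟫ ≤ Real.exp ⟪u j, y⟫ + ε ^ (K + 1)⁻¹ := by
      intro j
      have h1 := (hz j).2
      rw [neg_neg] at h1
      rcases le_max_iff.1 h1 with h | h
      · linarith [Real.exp_le_exp.2 h]
      · rw [hpow]
        linarith [Real.exp_le_exp.2 h, Real.exp_pos ⟪u j, y⟫]
    calc (⨅ y : E, ∑ j ∈ I, d j * Real.exp ⟪u j, y⟫)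
        ≤ ∑ j ∈ I, d j * Real.exp ⟪u j, z⟫ := iInf_expSum_le u h0 z
      _ ≤ ∑ j ∈ I, (d' j * Real.exp ⟪u j, y⟫ + (D + 1) * ε ^ (K + 1)⁻¹) := by
          refine Finset.sum_le_sum fun j hj => ?_
          have hj0 := (hd' j hj).1
          have h1 := mul_le_mul_of_nonneg_right (hdist j hj) (Real.exp_pos ⟪u j, z⟫).le
          have h2 := mul_le_mul_of_nonneg_left (hsmall j) hj0
          have h3 := mul_le_mul_of_nonneg_right (hd' j hj).2 hs.le
          linarith [hbig j]
      _ = (∑ j ∈ I, d' j * Real.exp ⟪u j, y⟫) + I.card * ((D + 1) * ε ^ (K + 1)⁻¹) := by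
          rw [Finset.sum_add_distrib, Finset.sum_const, nsmul_eq_mul]
      _ ≤ (∑ j ∈ I, d' j * Real.exp ⟪u j, y⟫) +
            Fintype.card J * ((D + 1) * ε ^ (K + 1)⁻¹) := by gcongr
      _ = _ := by ring
  · have hs1 : 1 ≤ ε ^ (K + 1)⁻¹ := Real.one_le_rpow hε1 hα.le
    have h1 : (⨅ y : E, ∑ j ∈ I, d j * Real.exp ⟪u j, y⟫) ≤ I.card * D := by
      refine (iInf_expSum_le u h0 0).trans ?_
      simpa using Finset.sum_le_card_nsmul I d D fun j hj => (hd j hj).2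
    have h2 := expSum_nonneg u (fun j hj => (hd' j hj).1) y
    have h3 : (I.card : ℝ) * D ≤ (D + 1) * Fintype.card J * ε ^ (K + 1)⁻¹ := by
      calc (I.card : ℝ) * D ≤ Fintype.card J * (D + 1) := by gcongr; linarith
        _ = (D + 1) * Fintype.card J := mul_comm _ _
        _ ≤ _ := le_mul_of_one_le_right (by positivity) hs1
    linarith

end ExponentialSums

/-- **Theorem (local Hölder continuity of `g_I`).**
Let `(u j)_{j ∈ J}` be pairwise distinct vectors in `ℝ^n`.  There exist `α ∈ (0,1)` and
`δ₀ > 0`, depending only on `(u j)`, such that for every `D > 0`, every `I ⊆ J` and all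
coefficient families `d, d' ∈ [0,D]^I`,
`|g_I(d) − g_I(d')| ≤ (D + |J| + 2D|J|δ₀⁻¹) * ‖d − d'‖_∞ ^ α`. -/
theorem gI_local_holder
    {n : ℕ} {J : Type*} [Fintype J] [DecidableEq J]
    (u : J → EuclideanSpace ℝ (Fin n)) (hu : Function.Injective u) :
    ∃ α ∈ Set.Ioo (0 : ℝ) 1, ∃ δ₀ > (0 : ℝ), ∀ D > (0 : ℝ), ∀ I : Finset J,
      ∀ d d' : J → ℝ, (∀ j ∈ I, d j ∈ Set.Icc (0 : ℝ) D) →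
        (∀ j ∈ I, d' j ∈ Set.Icc (0 : ℝ) D) →
        |(⨅ y : EuclideanSpace ℝ (Fin n), ∑ j ∈ I, d j * Real.exp ⟪u j, y⟫)
            - (⨅ y : EuclideanSpace ℝ (Fin n), ∑ j ∈ I, d' j * Real.exp ⟪u j, y⟫)|
          ≤ (D + (Fintype.card J : ℝ) + 2 * D * (Fintype.card J : ℝ) / δ₀)
              * (⨆ j ∈ I, |d j - d' j|) ^ α := by
  obtain ⟨K, hK1, hK⟩ := exists_inner_le_mul_and_le_max u
  refine ⟨(K + 1)⁻¹, ⟨by positivity, inv_lt_one_of_one_lt₀ (by linarith)⟩, 2, two_pos, ?_⟩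
  intro D hD I d d' hd hd'
  set ε : ℝ := ⨆ j ∈ I, |d j - d' j| with hε
  have hdist : ∀ j ∈ I, |d j - d' j| ≤ ε := by
    intro j hj
    have h := le_ciSup (f := fun j => ⨆ _ : j ∈ I, |d j - d' j|)
      (Set.finite_range _).bddAbove j
    simpa only [ciSup_pos hj] using h
  have hε0 : 0 ≤ ε := Real.iSup_nonneg fun j => Real.iSup_nonneg fun _ => abs_nonneg _
  have hconst : (D + 1) * Fintype.card J ≤
      D + (Fintype.card J : ℝ) + 2 * D * (Fintype.card J : ℝ) / 2 := by
    linarith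
  rcases hε0.eq_or_lt with h0 | hpos
  · have heq : ∀ j ∈ I, d j = d' j := fun j hj =>
      sub_eq_zero.1 (abs_nonpos_iff.1 ((hdist j hj).trans h0.ge))
    have hfun : (fun y : EuclideanSpace ℝ (Fin n) => ∑ j ∈ I, d j * Real.exp ⟪u j, y⟫) =
        fun y => ∑ j ∈ I, d' j * Real.exp ⟪u j, y⟫ :=
      funext fun y => Finset.sum_congr rfl fun j hj => by rw [heq j hj]
    rw [hfun, sub_self, abs_zero]
    positivity
  · have h1 := iInf_expSum_le_add hK1 hK hD.le hd hd' hpos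
      fun j hj => by linarith [(abs_le.1 (hdist j hj)).2]
    have h2 := iInf_expSum_le_add hK1 hK hD.le hd' hd hpos
      fun j hj => by linarith [(abs_le.1 (hdist j hj)).1]
    refine le_trans ?_ (mul_le_mul_of_nonneg_right hconst (Real.rpow_nonneg hε0 _))
    exact abs_sub_le_iff.2 ⟨by linarith, by linarith⟩
end

section
/- Fix a Brascamp–Lieb datum (L,p) with L_j : ℝ^n → ℝ^{n_j} linear surjections and exponents p_j, set M = n_1 + ··· + n_m, and identify each k ∈ {1,…,M} with a pair (j,ℓ) via k = n_0 + ··· + n_{j-1} + ℓ with n_0 = 0 and ℓ ∈ {1,…,n_j}. Let q ∈ ℝ^M be the vector whose k-th entry is p_j when k corresponds to (j,ℓ). Suppose for each j the positive definite n_j × n_j matrix A_j is written A_j = R_j* X_j R_j with R_j a rotation matrix and X_j diagonal with positive entries, and let y ∈ ℝ^M list the logarithms of the diagonal entries of X_1, …, X_m, so the k-th entry of y is y_k with the corresponding diagonal entry e^{y_k}. Let v_k = L_j* R_j* e_{(j,ℓ)} ∈ ℝ^n, where {e_{(j,ℓ)}} is the standard basis of ℝ^{n_j}. For each I ⊆ {1,…,M}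 with |I| = n, let u_I = 𝟙_I − q ∈ ℝ^M, q_I = ∏_{k∈I} q_k, and d_I = q_I · det((v_k)_{k∈I})². Then BL_g(L,p;A)^{-2} = ∑_{|I|=n} d_I · exp(⟨u_I, y⟩). -/
open scoped Matrix

/-- The gaussian Brascamp–Lieb constant
`BL_g(L,p;A) = ∏_j det(A_j)^{p_j/2} / det(∑_j p_j L_j* A_j L_j)^{1/2}`. -/
noncomputable def matBLg {m n : ℕ} (nj : Fin m → ℕ)
    (L : ∀ j, Matrix (Fin (nj j)) (Fin n) ℝ) (p : Fin m → ℝ)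
    (A : ∀ j, Matrix (Fin (nj j)) (Fin (nj j)) ℝ) : ℝ :=
  (∏ j, (A j).det ^ (p j / 2)) / (∑ j, p j • ((L j)ᴴ * A j * L j)).det ^ ((1 : ℝ) / 2)

/-- The column vector `v_k = L_j* R_j* e_{(j,ℓ)}`, for `k = (j,ℓ)`. -/
noncomputable def colVec {m n : ℕ} (nj : Fin m → ℕ)
    (L : ∀ j, Matrix (Fin (nj j)) (Fin n) ℝ)
    (R : ∀ j, Matrix (Fin (nj j)) (Fin (nj j)) ℝ)
    (k : Σ j : Fin m, Fin (nj j)) : Fin n → ℝ :=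
  ((L k.1)ᴴ * (R k.1)ᴴ).mulVec (Pi.single k.2 1)

/-- The term `d_I · exp ⟪u_I, y⟫` with `d_I = q_I det((v_k)_{k ∈ I})²` and
`u_I = 𝟙_I − q` (here the determinant is taken after an arbitrary enumeration of `I`;
its square is independent of this choice). -/
noncomputable def dTerm {m n : ℕ} (nj : Fin m → ℕ)
    (L : ∀ j, Matrix (Fin (nj j)) (Fin n) ℝ) (p : Fin m → ℝ)
    (R : ∀ j, Matrix (Fin (nj j)) (Fin (nj j)) ℝ)
    (y : (Σ j : Fin m, Fin (nj j)) → ℝ)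
    (I : Finset (Σ j : Fin m, Fin (nj j))) (hI : I.card = n) : ℝ :=
  (∏ k ∈ I, p k.1) *
    (Matrix.det (Matrix.of fun (a b : Fin n) =>
      colVec nj L R (((I.equivFin.trans (finCongr hI)).symm b : I) : Σ j : Fin m, Fin (nj j)) a)) ^ 2 *
    Real.exp (∑ k : Σ j : Fin m, Fin (nj j),
      ((if k ∈ I then (1 : ℝ) else 0) - p k.1) * y k)

/-- The Cauchy–Binet formula, with an arbitrary enumeration `e I` of each index set `I`. -/
theorem det_mul_eq_sum_powersetCard {R κ : Type*} [CommRing R] [Fintype κ] [DecidableEq κ] {n : ℕ}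
    (A : Matrix (Fin n) κ R) (B : Matrix κ (Fin n) R)
    (e : ∀ I : {I // I ∈ Finset.powersetCard n (Finset.univ : Finset κ)}, Fin n ≃ I.1) :
    (A * B).det = ∑ I ∈ (Finset.powersetCard n (Finset.univ : Finset κ)).attach,
      (A.submatrix id (fun b => (e I b : κ))).det * (B.submatrix (fun b => (e I b : κ)) id).det := by
  classical
  have expand : (A * B).det
      = ∑ f : Fin n → κ, (∏ i, A i (f i)) * (B.submatrix f id).det := by
    have hrow : A * B = fun i => ∑ k, A i k • B k := by
      ext i a
      simp [Matrix.mul_apply, Finset.sum_apply]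
    rw [hrow]
    change Matrix.detRowAlternating (fun i => ∑ k, A i k • B k) = _
    rw [← AlternatingMap.coe_multilinearMap, MultilinearMap.map_sum]
    refine Finset.sum_congr rfl fun f _ => ?_
    rw [MultilinearMap.map_smul_univ, smul_eq_mul]
    rfl
  have restrict : (A * B).det = ∑ f : Fin n → κ with Function.Injective f,
      (∏ i, A i (f i)) * (B.submatrix f id).det := by
    rw [expand]
    symm
    refine Finset.sum_filter_of_ne fun f _ hf => ?_
    by_contra hinj
    obtain ⟨i, j, hij, hne⟩ : ∃ i j, f i = f j ∧ i ≠ j := by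
      simpa [Function.Injective] using hinj
    refine hf ?_
    rw [Matrix.det_zero_of_row_eq hne (by ext a; simp [hij]), mul_zero]
  have term : ∀ I : {I // I ∈ Finset.powersetCard n (Finset.univ : Finset κ)},
      (A.submatrix id (fun b => (e I b : κ))).det * (B.submatrix (fun b => (e I b : κ)) id).det
        = ∑ σ : Equiv.Perm (Fin n), (∏ i, A i (e I (σ i))) *
            (B.submatrix (fun i => (e I (σ i) : κ)) id).det := by
    intro I
    rw [← Matrix.det_transpose, Matrix.det_apply', Finset.sum_mul]
    refine Finset.sum_congr rfl fun σ _ => ?_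
    have hperm : (B.submatrix (fun i => (e I (σ i) : κ)) id).det
        = (Equiv.Perm.sign σ : R) * (B.submatrix (fun b => (e I b : κ)) id).det :=
      Matrix.det_permute σ (B.submatrix (fun b => (e I b : κ)) id)
    rw [hperm]
    simp only [Matrix.transpose_apply, Matrix.submatrix_apply, id]
    ring
  rw [restrict, Finset.sum_congr rfl fun I _ => term I, ← Finset.sum_product']
  symm
  refine Finset.sum_bij (fun x _ i => (e x.1 (x.2 i) : κ)) ?_ ?_ ?_ ?_
  · rintro ⟨I, σ⟩ -
    exact Finset.mem_filter.mpr ⟨Finset.mem_univ _,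
      Subtype.val_injective.comp ((e I).injective.comp σ.injective)⟩
  · rintro ⟨I, σ⟩ - ⟨J, τ⟩ - h
    have range_eq : ∀ (I) (σ : Equiv.Perm (Fin n)),
        Set.range (fun i => (e I (σ i) : κ)) = (I.1 : Set κ) := by
      intro I σ
      ext k
      refine ⟨?_, fun hk => ⟨σ.symm ((e I).symm ⟨k, hk⟩), by simp⟩⟩
      rintro ⟨i, rfl⟩
      exact (e I (σ i)).2
    have hIJ : I = J := by
      apply Subtype.ext
      apply Finset.coe_injective
      rw [← range_eq I σ, ← range_eq J τ]
      exact congrArg Set.range h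
    subst hIJ
    have hστ : σ = τ := by
      ext i : 1
      exact (e I).injective (Subtype.ext (congrFun h i))
    rw [hστ]
  · intro f hf
    have hinj : Function.Injective f := by simpa using hf
    let I : {I // I ∈ Finset.powersetCard n (Finset.univ : Finset κ)} :=
      ⟨Finset.univ.image f, by
        simp [Finset.mem_powersetCard, Finset.card_image_of_injective _ hinj]⟩
    let g : Fin n → I.1 := fun i => ⟨f i, Finset.mem_image_of_mem f (Finset.mem_univ i)⟩
    have hg : Function.Injective ((e I).symm ∘ g) :=
      (e I).symm.injective.comp fun i j h => hinj (congrArg Subtype.val h)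
    refine ⟨(I, Equiv.ofBijective _ (Finite.injective_iff_bijective.mp hg)), by simp, ?_⟩
    funext i
    simp [g]
  · rintro ⟨I, σ⟩ -
    rfl

/-- Weighted Cauchy–Binet formula for a Gram-type matrix. -/
theorem det_mul_diagonal_mul_transpose {R κ : Type*} [CommRing R] [Fintype κ] [DecidableEq κ] {n : ℕ}
    (V : Matrix (Fin n) κ R) (w : κ → R)
    (e : ∀ I : {I // I ∈ Finset.powersetCard n (Finset.univ : Finset κ)}, Fin n ≃ I.1) :
    (V * Matrix.diagonal w * Vᵀ).det =
      ∑ I ∈ (Finset.powersetCard n (Finset.univ : Finset κ)).attach,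
        (∏ k ∈ I.1, w k) * (V.submatrix id (fun b => (e I b : κ))).det ^ 2 := by
  rw [det_mul_eq_sum_powersetCard _ _ e]
  refine Finset.sum_congr rfl fun I _ => ?_
  have hl : (V * Matrix.diagonal w).submatrix id (fun b => (e I b : κ))
      = V.submatrix id (fun b => (e I b : κ)) * Matrix.diagonal fun b => w (e I b) := by
    ext a b
    simp [Matrix.mul_diagonal]
  have hr : Vᵀ.submatrix (fun b => (e I b : κ)) id
      = (V.submatrix id (fun b => (e I b : κ)))ᵀ := rfl
  have hw : ∏ b, w (e I b) = ∏ k ∈ I.1, w k := by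
    rw [Equiv.prod_comp (e I) (fun k => w k), Finset.prod_coe_sort]
  rw [hl, hr, Matrix.det_mul, Matrix.det_diagonal, Matrix.det_transpose, hw]
  ring

/-- `∑_j p_j L_j* A_j L_j = V diag(q_k e^{y_k}) V*`, where `V` has columns `v_k`. -/
theorem sum_smul_conj_eq_mul_diagonal_mul_transpose {m n : ℕ} (nj : Fin m → ℕ)
    (L : ∀ j, Matrix (Fin (nj j)) (Fin n) ℝ) (p : Fin m → ℝ)
    (R : ∀ j, Matrix (Fin (nj j)) (Fin (nj j)) ℝ)
    (x : (Σ j : Fin m, Fin (nj j)) → ℝ) :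
    ∑ j, p j • ((L j)ᴴ * ((R j)ᴴ * Matrix.diagonal (fun ℓ => x ⟨j, ℓ⟩) * R j) * L j)
      = Matrix.of (fun a k => colVec nj L R k a) * Matrix.diagonal (fun k => p k.1 * x k) *
        (Matrix.of fun a k => colVec nj L R k a)ᵀ := by
  ext a b
  rw [Matrix.sum_apply, Matrix.mul_apply, Fintype.sum_sigma]
  refine Finset.sum_congr rfl fun j _ => ?_
  have hassoc : (L j)ᴴ * ((R j)ᴴ * Matrix.diagonal (fun ℓ => x ⟨j, ℓ⟩) * R j) * L j
      = (L j)ᴴ * (R j)ᴴ * Matrix.diagonal (fun ℓ => x ⟨j, ℓ⟩) * ((L j)ᴴ * (R j)ᴴ)ᵀ := by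
    simp [Matrix.mul_assoc, Matrix.conjTranspose_eq_transpose_of_trivial, Matrix.transpose_mul]
  rw [hassoc, Matrix.smul_apply, Matrix.mul_apply, Finset.smul_sum]
  refine Finset.sum_congr rfl fun ℓ _ => ?_
  simp only [Matrix.mul_diagonal, Matrix.transpose_apply, Matrix.of_apply, colVec,
    Matrix.mulVec_single_one, Matrix.col_apply, smul_eq_mul]
  ring

/-- The numerator of the gaussian Brascamp–Lieb constant in logarithmic coordinates. -/
theorem prod_det_rpow_eq_exp {m : ℕ} (nj : Fin m → ℕ) (p : Fin m → ℝ)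
    (R : ∀ j, Matrix (Fin (nj j)) (Fin (nj j)) ℝ)
    (hR : ∀ j, (R j)ᴴ * R j = 1)
    (y : (Σ j : Fin m, Fin (nj j)) → ℝ) :
    ∏ j, ((R j)ᴴ * Matrix.diagonal (fun ℓ => Real.exp (y ⟨j, ℓ⟩)) * R j).det ^ (p j / 2)
      = Real.exp ((∑ k : Σ j : Fin m, Fin (nj j), p k.1 * y k) / 2) := by
  rw [Fintype.sum_sigma, Finset.sum_div, Real.exp_sum]
  refine Finset.prod_congr rfl fun j _ => ?_
  have hdet : ((R j)ᴴ * Matrix.diagonal (fun ℓ => Real.exp (y ⟨j, ℓ⟩)) * R j).det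
      = Real.exp (∑ ℓ, y ⟨j, ℓ⟩) := by
    have h1 : (R j)ᴴ.det * (R j).det = 1 := by rw [← Matrix.det_mul, hR j, Matrix.det_one]
    rw [Matrix.det_mul, Matrix.det_mul, Matrix.det_diagonal, Real.exp_sum, mul_right_comm, h1,
      one_mul]
  rw [hdet, ← Real.exp_mul]
  simp only [← Finset.mul_sum]
  congr 1
  ring

/-- **Proposition (the gaussian Brascamp–Lieb constant as a sum of exponentials).**
With `A_j = R_j* X_j R_j`, `R_j` orthogonal and `X_j = diag(e^{y_k})`, one has
`BL_g(L,p;A)^{-2} = ∑_{|I| = n} d_I exp ⟪u_I, y⟫`. -/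
theorem gaussian_BL_exponential_identity
    {m n : ℕ} (nj : Fin m → ℕ)
    (L : ∀ j, Matrix (Fin (nj j)) (Fin n) ℝ) (p : Fin m → ℝ)
    (hL : ∀ j, Function.Surjective (Matrix.toEuclideanLin (L j)))
    (hp : ∀ j, p j ∈ Set.Icc (0 : ℝ) 1)
    (R : ∀ j, Matrix (Fin (nj j)) (Fin (nj j)) ℝ)
    (hR : ∀ j, (R j)ᴴ * R j = 1)
    (y : (Σ j : Fin m, Fin (nj j)) → ℝ)
    (A : ∀ j, Matrix (Fin (nj j)) (Fin (nj j)) ℝ)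
    (hA : ∀ j, A j = (R j)ᴴ * Matrix.diagonal (fun ℓ => Real.exp (y ⟨j, ℓ⟩)) * R j) :
    (matBLg nj L p A) ^ (-2 : ℝ)
      = ∑ I ∈ (Finset.powersetCard n
            (Finset.univ : Finset (Σ j : Fin m, Fin (nj j)))).attach,
          dTerm nj L p R y I.1 (Finset.mem_powersetCard.mp I.2).2 := by
  let e : ∀ I : {I // I ∈ Finset.powersetCard n
      (Finset.univ : Finset (Σ j : Fin m, Fin (nj j)))}, Fin n ≃ I.1 := fun I =>
    (I.1.equivFin.trans (finCongr (Finset.mem_powersetCard.mp I.2).2)).symm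
  have hdet := det_mul_diagonal_mul_transpose
    (Matrix.of fun a k => colVec nj L R k a) (fun k => p k.1 * Real.exp (y k)) e
  rw [← sum_smul_conj_eq_mul_diagonal_mul_transpose nj L p R fun k => Real.exp (y k)] at hdet
  have hnonneg : 0 ≤ (∑ j, p j • ((L j)ᴴ *
      ((R j)ᴴ * Matrix.diagonal (fun ℓ => Real.exp (y ⟨j, ℓ⟩)) * R j) * L j)).det := by
    rw [hdet]
    exact Finset.sum_nonneg fun I _ => mul_nonneg
      (Finset.prod_nonneg fun k _ => mul_nonneg (hp k.1).1 (Real.exp_pos _).le) (sq_nonneg _)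
  obtain rfl : A = fun j => (R j)ᴴ * Matrix.diagonal (fun ℓ => Real.exp (y ⟨j, ℓ⟩)) * R j :=
    funext hA
  rw [matBLg, prod_det_rpow_eq_exp nj p R hR y,
    Real.div_rpow (Real.exp_pos _).le (Real.rpow_nonneg hnonneg _), ← Real.exp_mul,
    ← Real.rpow_mul hnonneg, show (1 : ℝ) / 2 * -2 = -1 by norm_num, Real.rpow_neg_one,
    div_inv_eq_mul, hdet, Finset.mul_sum]
  refine Finset.sum_congr rfl fun I _ => ?_
  have hexp : Real.exp (∑ k : Σ j : Fin m, Fin (nj j),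
        ((if k ∈ I.1 then (1 : ℝ) else 0) - p k.1) * y k)
      = Real.exp ((∑ k : Σ j : Fin m, Fin (nj j), p k.1 * y k) / 2 * -2) *
        ∏ k ∈ I.1, Real.exp (y k) := by
    rw [← Real.exp_sum, ← Real.exp_add]
    congr 1
    simp only [sub_mul, Finset.sum_sub_distrib, ite_mul, one_mul, zero_mul, Finset.sum_ite_mem,
      Finset.univ_inter]
    ring
  rw [dTerm, hexp, Finset.prod_mul_distrib]
  have hsub : (Matrix.of fun (a b : Fin n) => colVec nj L R
        (((I.1.equivFin.trans (finCongr (Finset.mem_powersetCard.mp I.2).2)).symm b : I.1) :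
          Σ j : Fin m, Fin (nj j)) a)
      = (Matrix.of fun a k => colVec nj L R k a).submatrix id
          (fun b => (e I b : Σ j : Fin m, Fin (nj j))) := rfl
  rw [hsub]
  ring
end

section
/- Let (L,p) be a Brascamp–Lieb datum and let f = (f_j)_{j=1}^m and g = (g_j)_{j=1}^m be m-tuples of probability densities, i.e. nonnegative integrable functions on ℝ^{n_j} with ∫ f_j = ∫ g_j = 1. For x ∈ ℝ^n define h_j^x(z) = f_j(z) g_j(L_j x − z) and h^x = (h_j^x)_{j=1}^m, and let f*g = (f_j * g_j)_{j=1}^m. Then BL(L,p;f) · BL(L,p;g) ≤ (sup_{x∈ℝ^n} BL(L,p;h^x)) · BL(L,p;f*g). -/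
open MeasureTheory
open scoped ENNReal

/-- The Brascamp–Lieb functional of the datum `(L, p)` evaluated at the input `f`:
`BL(L,p;f) = ∫ ∏_j f_j(L_j x)^{p_j} dx / ∏_j (∫ f_j)^{p_j}`. -/
noncomputable def BLfunctional {m n : ℕ} (nj : Fin m → ℕ)
    (L : ∀ j, (Fin n → ℝ) →L[ℝ] (Fin (nj j) → ℝ)) (p : Fin m → ℝ)
    (f : ∀ j, (Fin (nj j) → ℝ) → ℝ≥0∞) : ℝ≥0∞ :=
  (∫⁻ x, ∏ j, (f j (L j x)) ^ (p j)) / ∏ j, (∫⁻ z, f j z) ^ (p j)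

/-- Pullback of an almost everywhere property along a surjective linear map. -/
theorem ae_comp_of_surjective {n k : ℕ} (L : (Fin n → ℝ) →L[ℝ] (Fin k → ℝ))
    (hL : Function.Surjective L) {P : (Fin k → ℝ) → Prop} (h : ∀ᵐ z, P z) :
    ∀ᵐ x, P (L x) := by
  have hq : Measure.QuasiMeasurePreserving L volume volume := by
    refine ⟨L.continuous.measurable, ?_⟩
    obtain ⟨c, -, hc⟩ :=
      LinearMap.exists_map_addHaar_eq_smul_addHaar L.toLinearMap volume volume hL
    have hc' : Measure.map L volume = _ := hc
    rw [hc']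
    exact Measure.smul_absolutelyContinuous
  exact hq.ae h

/-- The total mass of a convolution is the product of the total masses. -/
theorem lintegral_lintegral_mul_sub {k : ℕ} {u v : (Fin k → ℝ) → ℝ≥0∞}
    (hu : Measurable u) (hv : Measurable v) :
    ∫⁻ z, ∫⁻ w, u w * v (z - w) = (∫⁻ z, u z) * ∫⁻ z, v z := by
  rw [lintegral_lintegral_swap (by fun_prop)]
  have h : ∀ w, ∫⁻ z, u w * v (z - w) = u w * ∫⁻ z, v z := fun w => by
    rw [lintegral_const_mul _ (by fun_prop), lintegral_sub_right_eq_self]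
  simp_rw [h]
  rw [lintegral_mul_const _ hu]

/-- If some input has vanishing integral, so that the denominator of the Brascamp–Lieb functional
vanishes, then the numerator vanishes as well. -/
theorem lintegral_prod_rpow_eq_zero {m n : ℕ} (nj : Fin m → ℕ)
    (L : ∀ j, (Fin n → ℝ) →L[ℝ] (Fin (nj j) → ℝ)) (p : Fin m → ℝ)
    (hp : ∀ j, 0 ≤ p j) (hL : ∀ j, Function.Surjective (L j))
    (f : ∀ j, (Fin (nj j) → ℝ) → ℝ≥0∞) (hf : ∀ j, Measurable (f j))
    (h : ∏ j, (∫⁻ z, f j z) ^ (p j) = 0) :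
    ∫⁻ x, ∏ j, (f j (L j x)) ^ (p j) = 0 := by
  obtain ⟨j, hj, h0⟩ := Finset.prod_eq_zero_iff.1 h
  rcases ENNReal.rpow_eq_zero_iff.1 h0 with ⟨h1, h2⟩ | ⟨-, h2⟩
  · refine lintegral_eq_zero_of_ae_eq_zero ?_
    filter_upwards [ae_comp_of_surjective (L j) (hL j)
      ((lintegral_eq_zero_iff (hf j)).1 h1)] with x hx
    refine Finset.prod_eq_zero hj ?_
    rw [hx]
    exact ENNReal.zero_rpow_of_pos h2
  · exact absurd (hp j) (not_le.2 h2)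

/-- **Ball's inequality.**
Let `(L,p)` be a Brascamp–Lieb datum and `f = (f_j)`, `g = (g_j)` be `m`-tuples of
probability densities.  With `h_j^x(z) = f_j(z) g_j(L_j x − z)` and
`(f*g)_j = f_j * g_j` (convolution), one has
`BL(L,p;f) · BL(L,p;g) ≤ (sup_x BL(L,p;h^x)) · BL(L,p;f*g)`. -/
theorem ball_inequality
    {m n : ℕ} (nj : Fin m → ℕ)
    (L : ∀ j, (Fin n → ℝ) →L[ℝ] (Fin (nj j) → ℝ)) (p : Fin m → ℝ)
    (hp : ∀ j, p j ∈ Set.Icc (0 : ℝ) 1)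
    (hL : ∀ j, Function.Surjective (L j))
    (f g : ∀ j, (Fin (nj j) → ℝ) → ℝ≥0∞)
    (hf : ∀ j, Measurable (f j)) (hg : ∀ j, Measurable (g j))
    (hf1 : ∀ j, ∫⁻ z, f j z = 1) (hg1 : ∀ j, ∫⁻ z, g j z = 1) :
    BLfunctional nj L p f * BLfunctional nj L p g
      ≤ (⨆ x : Fin n → ℝ, BLfunctional nj L p (fun j z => f j z * g j (L j x - z)))
          * BLfunctional nj L p (fun j z => ∫⁻ w, f j w * g j (z - w)) := by
  have hp0 : ∀ j, 0 ≤ p j := fun j => (hp j).1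
  have hLm : ∀ j, Measurable (L j) := fun j => (L j).continuous.measurable
  have hconv : ∀ j, ∫⁻ z, ∫⁻ w, f j w * g j (z - w) = 1 := fun j => by
    rw [lintegral_lintegral_mul_sub (hf j) (hg j), hf1, hg1, one_mul]
  have hconvm : ∀ j, Measurable fun z => ∫⁻ w, f j w * g j (z - w) := fun j =>
    Measurable.lintegral_prod_right' (f := fun q : (Fin (nj j) → ℝ) × (Fin (nj j) → ℝ) =>
      f j q.2 * g j (q.1 - q.2)) (by fun_prop)
  have hfin : ∀ᵐ x : Fin n → ℝ, ∀ j, ∫⁻ w, f j w * g j (L j x - w) < ∞ :=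
    ae_all_iff.2 fun j => ae_comp_of_surjective (L j) (hL j)
      (ae_lt_top (hconvm j) (by rw [hconv j]; exact ENNReal.one_ne_top))
  set S := ⨆ x : Fin n → ℝ, BLfunctional nj L p (fun j z => f j z * g j (L j x - z))
  have hBf : BLfunctional nj L p f = ∫⁻ x, ∏ j, (f j (L j x)) ^ (p j) := by
    simp [BLfunctional, hf1]
  have hBg : BLfunctional nj L p g = ∫⁻ x, ∏ j, (g j (L j x)) ^ (p j) := by
    simp [BLfunctional, hg1]
  have hBc : BLfunctional nj L p (fun j z => ∫⁻ w, f j w * g j (z - w))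
      = ∫⁻ x, ∏ j, (∫⁻ w, f j w * g j (L j x - w)) ^ (p j) := by
    simp [BLfunctional, hconv]
  have hDm : Measurable fun x : Fin n → ℝ =>
      ∏ j, (∫⁻ w, f j w * g j (L j x - w)) ^ (p j) :=
    Finset.measurable_fun_prod _ fun j _ => ((hconvm j).comp (hLm j)).pow_const (p j)
  rw [hBf, hBg, hBc, ← lintegral_lintegral_mul_sub (by fun_prop) (by fun_prop),
    ← lintegral_const_mul S hDm]
  refine lintegral_mono_ae ?_
  filter_upwards [hfin] with x hx
  simp_rw [map_sub, ← Finset.prod_mul_distrib, ← ENNReal.mul_rpow_of_nonneg _ _ (hp0 _)]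
  have hD : ∏ j, (∫⁻ w, f j w * g j (L j x - w)) ^ (p j) ≠ ∞ :=
    ENNReal.prod_ne_top fun j _ => ENNReal.rpow_ne_top_of_nonneg (hp0 j) (hx j).ne
  by_cases h0 : ∏ j, (∫⁻ w, f j w * g j (L j x - w)) ^ (p j) = 0
  · rw [lintegral_prod_rpow_eq_zero nj L p hp0 hL (fun j z => f j z * g j (L j x - z))
      (fun j => by fun_prop) h0]
    exact zero_le
  · rw [← ENNReal.div_le_iff h0 hD]
    exact le_iSup (fun x : Fin n → ℝ =>
      BLfunctional nj L p (fun j z => f j z * g j (L j x - z))) x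
end

section
/- Let B_j : ℝ^n → ℝ^{n_j} be C² submersions in a neighbourhood of 0, p_j ∈ [0,1], ρ = ∑_{j=1}^m p_j, and fix α ∈ (1,2) and β ∈ (0, 2−α). There exists ν > 0, depending only on (B,p,α,β), with the following property: if u ∈ U_ν(0), κ > 1, δ ∈ (0,ν) and μ > 0 satisfy δ^{α+β} ≤ μ, then C(u,δ,μ,κ) ≤ κ^ρ · BL(dB(u), p), where dB(u) = (dB_j(u))_{j=1}^m. -/
open MeasureTheory
open scoped ENNReal

/-- The Brascamp–Lieb constant of the datum `(L, p)` on euclidean spaces. -/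
noncomputable def BLe {m n : ℕ} (nj : Fin m → ℕ)
    (L : ∀ j, EuclideanSpace ℝ (Fin n) →L[ℝ] EuclideanSpace ℝ (Fin (nj j)))
    (p : Fin m → ℝ) : ℝ≥0∞ :=
  sInf {C : ℝ≥0∞ | ∀ f : ∀ j, EuclideanSpace ℝ (Fin (nj j)) → ℝ≥0∞,
    (∀ j, Measurable (f j)) →
    ∫⁻ x, ∏ j, (f j (L j x)) ^ (p j) ≤ C * ∏ j, (∫⁻ xj, f j xj) ^ (p j)}

/-- The regularised and localised nonlinear Brascamp–Lieb constant `𝓒(u,δ,μ,κ)`: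
the smallest `C ∈ [0,∞]` such that
`∫_{U_δ(u)} ∏_j f_j(B_j y)^{p_j} dy ≤ C ∏_j (∫ f_j)^{p_j}` for all inputs
`f_j ∈ L¹(B_j(U_{2δ}(u)); μ, κ)`, i.e. nonnegative integrable `f_j` that are
`κ`-constant at scale `μ` on `B_j(U_{2δ}(u))`. -/
noncomputable def locC {m n : ℕ} (nj : Fin m → ℕ)
    (B : ∀ j, EuclideanSpace ℝ (Fin n) → EuclideanSpace ℝ (Fin (nj j)))
    (p : Fin m → ℝ) (u : EuclideanSpace ℝ (Fin n)) (δ μ κ : ℝ) : ℝ≥0∞ :=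
  sInf {C : ℝ≥0∞ | ∀ f : ∀ j, EuclideanSpace ℝ (Fin (nj j)) → ℝ≥0∞,
    (∀ j, Measurable (f j)) → (∀ j, ∫⁻ z, f j z ≠ ⊤) →
    (∀ j, ∀ x ∈ B j '' Metric.closedBall u (2 * δ), ∀ y, dist x y ≤ μ →
        f j x ≤ ENNReal.ofReal κ * f j y) →
    ∫⁻ y in Metric.closedBall u δ, ∏ j, (f j (B j y)) ^ (p j)
      ≤ C * ∏ j, (∫⁻ z, f j z) ^ (p j)}

open Filter Topology

/-- Second-order Taylor estimate: a `C²` map differs from its first-order expansion by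
`O(‖y - u‖²)`, which on a small ball of radius `δ` is at most `δ ^ s` for every `s < 2`. -/
lemma eventually_dist_affine_approx_le_rpow {E F : Type*}
    [NormedAddCommGroup E] [NormedSpace ℝ E] [NormedAddCommGroup F] [NormedSpace ℝ F]
    {f : E → F} {x₀ : E} (hf : ContDiffAt ℝ 2 f x₀) {s : ℝ} (hs : s < 2) :
    ∀ᶠ ν in 𝓝[>] (0 : ℝ), ∀ u ∈ Metric.closedBall x₀ ν, ∀ δ ∈ Set.Ioo (0 : ℝ) ν,
      ∀ y ∈ Metric.closedBall u δ, dist (f y) (f u + fderiv ℝ f u (y - u)) ≤ δ ^ s := by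
  obtain ⟨K, t, ht, hK⟩ := (hf.fderiv_right (m := 1) (by norm_num)).exists_lipschitzOnWith
  have hdiff : ∀ᶠ x in 𝓝 x₀, DifferentiableAt ℝ f x :=
    (hf.eventually (by simp)).mono fun x hx ↦ hx.differentiableAt (by simp)
  obtain ⟨r, hr, hball⟩ := Metric.eventually_nhds_iff_ball.1 (hdiff.and ht)
  have hpow : Tendsto (fun ν : ℝ ↦ (K : ℝ) * ν ^ (2 - s)) (𝓝[>] 0) (𝓝 0) := by
    have h := ((Real.continuousAt_rpow_const 0 (2 - s) (Or.inr (by linarith))).tendsto.mono_left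
      (nhdsWithin_le_nhds (s := Set.Ioi 0))).const_mul (K : ℝ)
    rwa [Real.zero_rpow (by linarith), mul_zero] at h
  filter_upwards [hpow.eventually_le_const one_pos, self_mem_nhdsWithin,
    nhdsWithin_le_nhds (Iio_mem_nhds (half_pos hr))] with ν hν hν0 hνr u hu δ hδ y hy
  simp only [Set.mem_Ioi, Set.mem_Iio] at hν0 hνr
  have hsub : ∀ z ∈ Metric.closedBall u δ, z ∈ Metric.ball x₀ r := fun z hz ↦ by
    rw [Metric.mem_closedBall] at hz hu
    rw [Metric.mem_ball]
    linarith [dist_triangle z u x₀, hδ.2]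
  have hu' : u ∈ Metric.closedBall u δ := Metric.mem_closedBall_self hδ.1.le
  have hderiv : ∀ z ∈ Metric.closedBall u δ, ‖fderiv ℝ f z - fderiv ℝ f u‖ ≤ K * δ :=
    fun z hz ↦ by
      rw [← dist_eq_norm]
      exact (hK.dist_le_mul z (hball z (hsub z hz)).2 u (hball u (hsub u hu')).2).trans
        (mul_le_mul_of_nonneg_left hz K.2)
  have htaylor : ‖f y - f u - fderiv ℝ f u (y - u)‖ ≤ K * δ * ‖y - u‖ :=
    (convex_closedBall u δ).norm_image_sub_le_of_norm_hasFDerivWithin_le'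
      (fun z hz ↦ (hball z (hsub z hz)).1.hasFDerivAt.hasFDerivWithinAt) hderiv hu' hy
  have hKδ : (K : ℝ) * δ ^ (2 - s) ≤ 1 :=
    (mul_le_mul_of_nonneg_left
      (Real.rpow_le_rpow hδ.1.le hδ.2.le (by linarith)) K.2).trans hν
  have hsq : δ * δ = δ ^ (2 - s) * δ ^ s := by
    rw [← Real.rpow_add hδ.1, sub_add_cancel, Real.rpow_two, sq]
  calc dist (f y) (f u + fderiv ℝ f u (y - u))
      = ‖f y - f u - fderiv ℝ f u (y - u)‖ := by rw [dist_eq_norm, sub_sub]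
    _ ≤ K * δ * δ := htaylor.trans <| mul_le_mul_of_nonneg_left
        (by rwa [← dist_eq_norm]) (mul_nonneg K.2 hδ.1.le)
    _ = K * δ ^ (2 - s) * δ ^ s := by rw [mul_assoc, hsq, mul_assoc]
    _ ≤ δ ^ s := mul_le_of_le_one_left (Real.rpow_nonneg hδ.1.le s) hKδ

/-- If each `B j` is within `μ` of its first-order expansion at `u` throughout the ball of
radius `δ`, then inputs that are `κ`-constant at scale `μ` see only the linearised datum. -/
lemma locC_le_of_dist_affine_approx_le {m n : ℕ} (nj : Fin m → ℕ)
    (B : ∀ j, EuclideanSpace ℝ (Fin n) → EuclideanSpace ℝ (Fin (nj j)))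
    (L : ∀ j, EuclideanSpace ℝ (Fin n) →L[ℝ] EuclideanSpace ℝ (Fin (nj j)))
    (p : Fin m → ℝ) (hp : ∀ j, 0 ≤ p j) (u : EuclideanSpace ℝ (Fin n)) {δ μ κ : ℝ}
    (hδ : 0 ≤ δ) (hκ : 0 < κ)
    (happrox : ∀ j, ∀ y ∈ Metric.closedBall u δ, dist (B j y) (B j u + L j (y - u)) ≤ μ) :
    locC nj B p u δ μ κ ≤ ENNReal.ofReal (κ ^ (∑ j, p j)) * BLe nj L p := by
  have hc : ENNReal.ofReal (κ ^ (∑ j, p j)) ≠ 0 := by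
    simpa using Real.rpow_pos_of_pos hκ _
  have hprod : ENNReal.ofReal (κ ^ (∑ j, p j)) = ∏ j, ENNReal.ofReal κ ^ p j := by
    rw [Real.rpow_sum_of_pos hκ,
      ENNReal.ofReal_prod_of_nonneg fun j _ ↦ Real.rpow_nonneg hκ.le _]
    exact Finset.prod_congr rfl fun j _ ↦ (ENNReal.ofReal_rpow_of_pos hκ).symm
  rw [mul_comm, ← ENNReal.div_le_iff hc ENNReal.ofReal_ne_top]
  refine le_sInf fun C hC ↦ ?_
  rw [ENNReal.div_le_iff hc ENNReal.ofReal_ne_top]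
  refine sInf_le fun f hf _ hconst ↦ ?_
  have hBL := hC (fun j z ↦ f j (B j u + z)) fun j ↦ (hf j).comp (measurable_const_add _)
  simp only [lintegral_add_left_eq_self] at hBL
  calc ∫⁻ y in Metric.closedBall u δ, ∏ j, f j (B j y) ^ p j
      ≤ ∫⁻ y in Metric.closedBall u δ, ENNReal.ofReal (κ ^ (∑ j, p j)) *
          ∏ j, f j (B j u + L j (y - u)) ^ p j := by
        refine setLIntegral_mono' measurableSet_closedBall fun y hy ↦ ?_
        rw [hprod, ← Finset.prod_mul_distrib]
        refine Finset.prod_le_prod' fun j _ ↦ ?_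
        rw [← ENNReal.mul_rpow_of_nonneg _ _ (hp j)]
        exact ENNReal.rpow_le_rpow (hconst j _ (Set.mem_image_of_mem _
          (Metric.closedBall_subset_closedBall (by linarith) hy)) _ (happrox j y hy)) (hp j)
    _ ≤ ∫⁻ y, ENNReal.ofReal (κ ^ (∑ j, p j)) * ∏ j, f j (B j u + L j (y - u)) ^ p j :=
        setLIntegral_le_lintegral _ _
    _ = ENNReal.ofReal (κ ^ (∑ j, p j)) * ∫⁻ y, ∏ j, f j (B j u + L j y) ^ p j := by
        rw [lintegral_const_mul' _ _ ENNReal.ofReal_ne_top,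
          lintegral_sub_right_eq_self (fun y ↦ ∏ j, f j (B j u + L j y) ^ p j) u]
    _ ≤ ENNReal.ofReal (κ ^ (∑ j, p j)) * (C * ∏ j, (∫⁻ z, f j z) ^ p j) := by gcongr
    _ = C * ENNReal.ofReal (κ ^ (∑ j, p j)) * ∏ j, (∫⁻ z, f j z) ^ p j := by ring

/-- **Proposition (base case of the induction on scales).**
Let `B_j : ℝ^n → ℝ^{n_j}` be `C²` submersions near `0`, `p_j ∈ [0,1]`,
`ρ = ∑_j p_j`, `α ∈ (1,2)` and `β ∈ (0,2−α)`.  There is `ν > 0` such that if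
`u ∈ U_ν(0)`, `κ > 1`, `δ ∈ (0,ν)` and `μ > 0` satisfy `δ^{α+β} ≤ μ`, then
`𝓒(u,δ,μ,κ) ≤ κ^ρ · BL(dB(u), p)`. -/
theorem induction_base_case
    {m n : ℕ} (nj : Fin m → ℕ)
    (B : ∀ j, EuclideanSpace ℝ (Fin n) → EuclideanSpace ℝ (Fin (nj j)))
    (p : Fin m → ℝ) (hp : ∀ j, p j ∈ Set.Icc (0 : ℝ) 1)
    (hB : ∀ j, ∃ V ∈ nhds (0 : EuclideanSpace ℝ (Fin n)), IsOpen V ∧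
      ContDiffOn ℝ 2 (B j) V ∧ ∀ x ∈ V, Function.Surjective (fderiv ℝ (B j) x))
    (α β : ℝ) (hα : α ∈ Set.Ioo (1 : ℝ) 2) (hβ : β ∈ Set.Ioo (0 : ℝ) (2 - α)) :
    ∃ ν > (0 : ℝ), ∀ u ∈ Metric.closedBall (0 : EuclideanSpace ℝ (Fin n)) ν,
      ∀ κ > (1 : ℝ), ∀ δ ∈ Set.Ioo (0 : ℝ) ν, ∀ μ > (0 : ℝ), δ ^ (α + β) ≤ μ →
        locC nj B p u δ μ κ
          ≤ ENNReal.ofReal (κ ^ (∑ j, p j))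
              * BLe nj (fun j => fderiv ℝ (B j) u) p := by
  have happrox := eventually_all.2 fun j ↦ by
    obtain ⟨V, hV, -, hBV, -⟩ := hB j
    exact eventually_dist_affine_approx_le_rpow (hBV.contDiffAt hV)
      (s := α + β) (by linarith [hβ.2])
  obtain ⟨ν, hν, hν0⟩ := (happrox.and self_mem_nhdsWithin).exists
  refine ⟨ν, hν0, fun u hu κ hκ δ hδ μ _ hδμ ↦ ?_⟩
  exact locC_le_of_dist_affine_approx_le nj B _ p (fun j ↦ (hp j).1) u hδ.1.le
    (zero_lt_one.trans hκ) fun j y hy ↦ (hν j u hu δ hδ y hy).trans hδμ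
end
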